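/- arXiv:1807.02289 — 11 statements merged into one kernel-verified Lean document; each statement's English description precedes it below -/
import Mathlib

section
/- Let p ≥ 1, let L be a lattice with 𝔼^p ⊆ L ⊆ ℤ^p, and set q = q(L). Then for every u ∈ ℤ^p and every s ∈ ℕ^p with all s_k ≥ 1, the number of points of L in the integer box ∏_{k=1}^p {u_k, u_k+1, …, u_k+s_k−1} satisfies 2^{q−p} · ∏_{k: e_k ∉ L} (2⌊s_k/2⌋) · ∏_{k: e_k ∈ L} s_k ≤ |L ∩ ∏_{k=1}^p {u_k,…,u_k+s_k−1}| ≤ 2^{q−p} · ∏_{k: e_k ∉ L} (2⌈s_k/2⌉) · ∏_{k: e_k ∈ L} s_k. (This is the size bound of Theorem 1: every L-based design with span vector s is, up to coordinatewise scaling and translation, such a box intersection, so its size m(D) obeys these bounds.) -/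
open Finset in
/-- Averaging over translations: if each weight `g k` is constant or the `k`-th unit vector
lies in the code `C`, then the weighted sum over `C` is determined by the total weights. -/
theorem AddSubgroup.two_pow_mul_sum_prod_eq {p : ℕ} (C : AddSubgroup (Fin p → ZMod 2))
    [DecidablePred (· ∈ C)] (g : Fin p → ZMod 2 → ℕ)
    (hg : ∀ k, Pi.single k 1 ∈ C ∨ g k 0 = g k 1) :
    2 ^ p * ∑ a ∈ univ.filter (· ∈ C), ∏ k, g k (a k) =
      (univ.filter (· ∈ C)).card * ∏ k, (g k 0 + g k 1) := by
  classical
  have translate (d : Fin p → ZMod 2) :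
      ∑ a ∈ univ.filter (· ∈ C), ∏ k, g k (a k + d k) =
        ∑ a ∈ univ.filter (· ∈ C), ∏ k, g k (a k) := by
    set d' : Fin p → ZMod 2 := fun k => if Pi.single k 1 ∈ C then d k else 0 with hd'
    have hmem : d' ∈ C := by
      rw [← Finset.univ_sum_single d']
      refine sum_mem fun k _ => ?_
      by_cases hk : Pi.single k 1 ∈ C
      · have h01 : ∀ z : ZMod 2, z = 0 ∨ z = 1 := by decide
        rcases h01 (d' k) with h | h
        · simp [h]
        · rwa [h]
      · simp [hd', hk]
    have hgd (a : Fin p → ZMod 2) (k : Fin p) : g k (a k + d k) = g k (a k + d' k) := by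
      by_cases hk : Pi.single k 1 ∈ C
      · simp [hd', hk]
      · have hconst : ∀ z, g k z = g k 0 := by
          have h01 : ∀ z : ZMod 2, z = 0 ∨ z = 1 := by decide
          intro z
          rcases h01 z with rfl | rfl
          · rfl
          · exact ((hg k).resolve_left hk).symm
        rw [hconst, hconst (a k + d' k)]
    simp only [hgd]
    refine Finset.sum_equiv (Equiv.addRight d') (fun a => ?_) (fun a _ => rfl)
    simp [C.add_mem_cancel_right hmem]
  have total (a : Fin p → ZMod 2) :
      ∑ d : Fin p → ZMod 2, ∏ k, g k (a k + d k) = ∏ k, (g k 0 + g k 1) := by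
    rw [← Fintype.prod_sum fun k z => g k (a k + z)]
    refine Finset.prod_congr rfl fun k _ => ?_
    exact (Equiv.sum_comp (Equiv.addLeft (a k)) (g k)).trans (Fin.sum_univ_two (g k))
  calc 2 ^ p * ∑ a ∈ univ.filter (· ∈ C), ∏ k, g k (a k)
      = ∑ d : Fin p → ZMod 2, ∑ a ∈ univ.filter (· ∈ C), ∏ k, g k (a k + d k) := by
        simp [translate]
    _ = _ := by
        rw [Finset.sum_comm]
        simp [total]

/-- The number of integers of residue `i` modulo two among `n` consecutive ones starting at `u`. -/
noncomputable def residueCount (u : ℤ) (n : ℕ) (i : ZMod 2) : ℕ :=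
  ((Finset.Ico u (u + n)).filter fun t : ℤ => (t : ZMod 2) = i).card

theorem residueCount_add_two (u : ℤ) (n : ℕ) (i : ZMod 2) :
    residueCount u (n + 2) i = residueCount u n i + 1 := by
  have hIco : Finset.Ico u (u + (n + 2 : ℕ)) =
      insert (u + n) (insert (u + n + 1) (Finset.Ico u (u + n))) := by
    ext t
    simp only [Finset.mem_insert, Finset.mem_Ico]
    omega
  have hpar : ∀ z : ZMod 2, (z = i ∧ z + 1 ≠ i) ∨ (z ≠ i ∧ z + 1 = i) := by
    revert i; decide
  unfold residueCount
  rw [hIco, Finset.filter_insert, Finset.filter_insert]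
  push_cast
  rcases hpar ((u : ZMod 2) + n) with ⟨h1, h2⟩ | ⟨h1, h2⟩
  · rw [if_pos h1, if_neg h2, Finset.card_insert_of_notMem (by simp)]
  · rw [if_neg h1, if_pos h2, Finset.card_insert_of_notMem (by simp)]

theorem residueCount_bounds (u : ℤ) (n : ℕ) (i : ZMod 2) :
    n / 2 ≤ residueCount u n i ∧ residueCount u n i ≤ (n + 1) / 2 := by
  induction n using Nat.twoStepInduction with
  | zero => simp [residueCount]
  | one =>
    have : residueCount u 1 i ≤ (Finset.Ico u (u + (1 : ℕ))).card := Finset.card_filter_le _ _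
    simpa using this
  | more n ih _ =>
    rw [residueCount_add_two]
    omega

theorem residueCount_zero_add_one (u : ℤ) (n : ℕ) :
    residueCount u n 0 + residueCount u n 1 = n := by
  have h : ∀ z : ZMod 2, z = 1 ↔ ¬ z = 0 := by decide
  simp only [residueCount, h]
  rw [Finset.card_filter_add_card_filter_not]
  simp

/-- Coordinatewise reduction of integer vectors modulo two. -/
def reduceModTwo (p : ℕ) : (Fin p → ℤ) →+ (Fin p → ZMod 2) :=
  (Int.castAddHom (ZMod 2)).compLeft (Fin p)

@[simp]
theorem reduceModTwo_apply {p : ℕ} (x : Fin p → ℤ) (k : Fin p) :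
    reduceModTwo p x k = (x k : ZMod 2) := rfl

section EvenLattice

variable {p : ℕ} {L : AddSubgroup (Fin p → ℤ)}

theorem reduceModTwo_mem_map_iff (hE : ∀ x : Fin p → ℤ, (∀ k, Even (x k)) → x ∈ L)
    (x : Fin p → ℤ) : reduceModTwo p x ∈ L.map (reduceModTwo p) ↔ x ∈ L := by
  refine ⟨fun ⟨y, hy, hxy⟩ => ?_, AddSubgroup.mem_map_of_mem _⟩
  rw [← sub_add_cancel x y]
  refine L.add_mem (hE _ fun k => ?_) hy
  rw [← ZMod.intCast_eq_zero_iff_even]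
  simpa [sub_eq_zero] using (congrFun hxy k).symm

theorem single_mem_map_reduceModTwo_iff (hE : ∀ x : Fin p → ℤ, (∀ k, Even (x k)) → x ∈ L)
    (k : Fin p) :
    Pi.single k 1 ∈ L.map (reduceModTwo p) ↔ Pi.single k (1 : ℤ) ∈ L := by
  rw [← reduceModTwo_mem_map_iff hE]
  have : reduceModTwo p (Pi.single k 1) = Pi.single k 1 := by
    ext j
    by_cases h : j = k
    · subst h; simp
    · simp [h]
  rw [this]

open Classical Finset in
theorem ncard_box_eq_sum (hE : ∀ x : Fin p → ℤ, (∀ k, Even (x k)) → x ∈ L)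
    (u : Fin p → ℤ) (s : Fin p → ℕ) :
    Set.ncard {x : Fin p → ℤ | x ∈ L ∧ ∀ k, u k ≤ x k ∧ x k < u k + s k} =
      ∑ a ∈ univ.filter (· ∈ L.map (reduceModTwo p)), ∏ k, residueCount (u k) (s k) (a k) := by
  have hset : {x : Fin p → ℤ | x ∈ L ∧ ∀ k, u k ≤ x k ∧ x k < u k + s k} =
      ↑((Fintype.piFinset fun k => Ico (u k) (u k + s k)).filter (· ∈ L)) := by
    ext x
    simp [and_comm]
  rw [hset, Set.ncard_coe_finset, card_eq_sum_card_fiberwise (f := reduceModTwo p)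
    (t := univ.filter (· ∈ L.map (reduceModTwo p)))]
  · refine sum_congr rfl fun a ha => ?_
    simp only [residueCount]
    rw [← Fintype.card_piFinset]
    congr 1
    ext x
    simp only [mem_filter, Fintype.mem_piFinset, forall_and, mem_univ, true_and] at ha ⊢
    have hx : reduceModTwo p x = a ↔ ∀ k, (x k : ZMod 2) = a k := funext_iff
    rw [← hx]
    refine ⟨fun h => ⟨h.1.1, h.2⟩, fun h => ⟨⟨h.1, ?_⟩, h.2⟩⟩
    rwa [← reduceModTwo_mem_map_iff hE, h.2]
  · intro x hx
    simp only [coe_filter, Set.mem_ofPred_eq, mem_univ, true_and] at hx ⊢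
    exact AddSubgroup.mem_map_of_mem _ hx.2

open Classical Finset in
theorem ncard_unit_cube_eq_card (hE : ∀ x : Fin p → ℤ, (∀ k, Even (x k)) → x ∈ L) :
    Set.ncard {x : Fin p → ℤ | x ∈ L ∧ ∀ k, x k = 0 ∨ x k = 1} =
      (univ.filter (· ∈ L.map (reduceModTwo p))).card := by
  have h := ncard_box_eq_sum hE 0 fun _ => 2
  have hset (x : Fin p → ℤ) (k : Fin p) :
      ((0 : Fin p → ℤ) k ≤ x k ∧ x k < (0 : Fin p → ℤ) k + (2 : ℕ)) ↔ x k = 0 ∨ x k = 1 := by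
    simp only [Pi.zero_apply]
    omega
  have hone (v : ℤ) (i : ZMod 2) : residueCount v 2 i = 1 := by
    have := residueCount_bounds v 2 i
    omega
  simpa only [hset, hone, prod_const_one, sum_const, smul_eq_mul, mul_one] using h

open Classical Finset in
/-- The weighted count in which coordinates `k` with `e_k ∉ L` get the constant weight `f k`. -/
theorem two_pow_mul_sum_prod_ite (hE : ∀ x : Fin p → ℤ, (∀ k, Even (x k)) → x ∈ L)
    (u : Fin p → ℤ) (s f : Fin p → ℕ) :
    2 ^ p * ∑ a ∈ univ.filter (· ∈ L.map (reduceModTwo p)),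
        ∏ k, (if Pi.single k (1 : ℤ) ∈ L then residueCount (u k) (s k) (a k) else f k) =
      Set.ncard {x : Fin p → ℤ | x ∈ L ∧ ∀ k, x k = 0 ∨ x k = 1} *
        (∏ k ∈ univ.filter fun k => Pi.single k (1 : ℤ) ∉ L, 2 * f k) *
        (∏ k ∈ univ.filter fun k => Pi.single k (1 : ℤ) ∈ L, s k) := by
  rw [ncard_unit_cube_eq_card hE, AddSubgroup.two_pow_mul_sum_prod_eq _
    (fun k z => if Pi.single k (1 : ℤ) ∈ L then residueCount (u k) (s k) z else f k),
    mul_assoc, mul_comm (∏ k ∈ univ.filter fun k => Pi.single k (1 : ℤ) ∉ L, 2 * f k),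
    ← prod_ite]
  · congr 1
    refine prod_congr rfl fun k _ => ?_
    split_ifs
    · exact residueCount_zero_add_one _ _
    · ring
  · intro k
    rw [single_mem_map_reduceModTwo_iff hE]
    by_cases hk : Pi.single k (1 : ℤ) ∈ L
    · exact Or.inl hk
    · simp [hk]

end EvenLattice

open Classical in
/-- Theorem 1 (size bounds): for a lattice `L` with `𝔼^p ⊆ L ⊆ ℤ^p` with
`|L ∩ {0,1}^p| = 2^q`, the number of points of `L` in any integer box with side
lengths `s_k` satisfies
`2^{q-p} ∏_{e_k∉L} (2⌊s_k/2⌋) ∏_{e_k∈L} s_k ≤ m ≤ 2^{q-p} ∏_{e_k∉L} (2⌈s_k/2⌉) ∏_{e_k∈L} s_k`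
(stated here multiplied through by `2^p`). -/
theorem stmt_0 (p : ℕ) (hp : 1 ≤ p) (L : AddSubgroup (Fin p → ℤ))
    (hE : ∀ x : Fin p → ℤ, (∀ k, Even (x k)) → x ∈ L)
    (q : ℕ)
    (hq : Set.ncard {x : Fin p → ℤ | x ∈ L ∧ ∀ k, x k = 0 ∨ x k = 1} = 2 ^ q)
    (u : Fin p → ℤ) (s : Fin p → ℕ) (hs : ∀ k, 1 ≤ s k) :
    2 ^ q * (∏ k ∈ Finset.univ.filter fun k => Pi.single k (1 : ℤ) ∉ L, 2 * (s k / 2)) *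
        (∏ k ∈ Finset.univ.filter fun k => Pi.single k (1 : ℤ) ∈ L, s k) ≤
      Set.ncard {x : Fin p → ℤ | x ∈ L ∧ ∀ k, u k ≤ x k ∧ x k < u k + s k} * 2 ^ p ∧
    Set.ncard {x : Fin p → ℤ | x ∈ L ∧ ∀ k, u k ≤ x k ∧ x k < u k + s k} * 2 ^ p ≤
      2 ^ q * (∏ k ∈ Finset.univ.filter fun k => Pi.single k (1 : ℤ) ∉ L, 2 * ((s k + 1) / 2)) *
        (∏ k ∈ Finset.univ.filter fun k => Pi.single k (1 : ℤ) ∈ L, s k) := by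
  rw [← hq, ← two_pow_mul_sum_prod_ite hE u s fun k => s k / 2,
    ← two_pow_mul_sum_prod_ite hE u s fun k => (s k + 1) / 2, ncard_box_eq_sum hE,
    mul_comm _ (2 ^ p)]
  constructor
  all_goals
    refine Nat.mul_le_mul_left _ (Finset.sum_le_sum fun a _ => Finset.prod_le_prod' fun k _ => ?_)
    split_ifs
    · exact le_rfl
  · exact (residueCount_bounds _ _ _).1
  · exact (residueCount_bounds _ _ _).2
end

section
/- Let p ≥ 1 and let L be a lattice with 𝔼^p ⊆ L ⊆ ℤ^p. Then for every s ∈ ℕ^p with all s_k ≥ 1 and every u ∈ ℤ^p, |L ∩ ∏_{k=1}^p {u_k, u_k+1, …, u_k+s_k−1}| ≤ |L ∩ ∏_{k=1}^p {0, 1, …, s_k−1}|. In other words, among all translates of the box, the count of lattice points is maximized by the box anchored at the origin; hence among all L-based designs with the same span vector s, the maximal size m(D) is attained by a design containing the origin 0_p (second part of Theorem 1). -/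
/-- In a subgroup of a power of `G`, prescribing some coordinates cuts out at most as many elements
as prescribing those coordinates to vanish. -/
lemma AddSubgroup.card_filter_coords_eq_le {ι G : Type*} [Fintype ι] [DecidableEq ι] [AddGroup G]
    [Fintype G] [DecidableEq G] (C : AddSubgroup (ι → G)) [DecidablePred (· ∈ C)]
    (t : Finset ι) (v : ι → G) :
    (Finset.univ.filter fun c : ι → G => c ∈ C ∧ ∀ k ∈ t, c k = v k).card ≤
      (Finset.univ.filter fun c : ι → G => c ∈ C ∧ ∀ k ∈ t, c k = 0).card := by
  rcases (Finset.univ.filter fun c : ι → G => c ∈ C ∧ ∀ k ∈ t, c k = v k).eq_empty_or_nonempty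
    with h | ⟨d, hd⟩
  · simp [h]
  · simp only [Finset.mem_filter, Finset.mem_univ, true_and] at hd
    refine Finset.card_le_card_of_injOn (fun c => c - d) (fun c hc => ?_)
      (sub_left_injective.injOn)
    simp only [Finset.coe_filter, Finset.mem_univ, true_and, Set.mem_ofPred_eq] at hc ⊢
    exact ⟨C.sub_mem hc.1 hd.1, fun k hk => by simp [hc.2 k hk, hd.2 k hk]⟩

lemma AddSubgroup.sum_prod_add_ite_le {ι G : Type*} [Fintype ι] [DecidableEq ι] [AddGroup G]
    [Fintype G] [DecidableEq G] (C : AddSubgroup (ι → G)) [DecidablePred (· ∈ C)]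
    (a b : ι → ℕ) (v : ι → G) :
    ∑ c : ι → G with c ∈ C, ∏ k, ((if c k = v k then b k else 0) + a k) ≤
      ∑ c : ι → G with c ∈ C, ∏ k, ((if c k = 0 then b k else 0) + a k) := by
  have expand (w : ι → G) :
      ∑ c : ι → G with c ∈ C, ∏ k, ((if c k = w k then b k else 0) + a k) =
        ∑ t : Finset ι, (Finset.univ.filter fun c : ι → G => c ∈ C ∧ ∀ k ∈ t, c k = w k).card *
          ((∏ k ∈ t, b k) * ∏ k ∈ Finset.univ \ t, a k) := by
    simp_rw [Finset.prod_add, Finset.powerset_univ]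
    rw [Finset.sum_comm]
    refine Finset.sum_congr rfl fun t _ => ?_
    simp_rw [Finset.prod_ite_zero, ite_mul, zero_mul]
    rw [← Finset.sum_filter, Finset.sum_const, Finset.filter_filter, smul_eq_mul]
  rw [expand v, expand fun _ => 0]
  exact Finset.sum_le_sum fun t _ => Nat.mul_le_mul_right _ (C.card_filter_coords_eq_le t v)

lemma Int.card_Ico_filter_cast_zmod_two (u : ℤ) (s : ℕ) (c : ZMod 2) :
    ((Finset.Ico u (u + s)).filter fun x : ℤ => (x : ZMod 2) = c).card =
      (if c = (u : ZMod 2) then s % 2 else 0) + s / 2 := by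
  obtain ⟨d, rfl⟩ := ZMod.intCast_surjective c
  simp_rw [ZMod.intCast_eq_intCast_iff']
  induction s with
  | zero => simp
  | succ s ih =>
    have h : Finset.Ico u (u + (s + 1 : ℕ)) = insert (u + s) (Finset.Ico u (u + s)) := by
      ext x
      simp only [Finset.mem_Ico, Finset.mem_insert]
      omega
    rw [h, Finset.filter_insert, apply_ite Finset.card, Finset.card_insert_of_notMem (by simp), ih]
    push_cast
    split_ifs <;> omega

lemma AddSubgroup.mem_iff_cast_mem_map_zmod_two {ι : Type*} {L : AddSubgroup (ι → ℤ)}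
    (hE : ∀ x : ι → ℤ, (∀ k, Even (x k)) → x ∈ L) (x : ι → ℤ) :
    x ∈ L ↔ (fun k => (x k : ZMod 2)) ∈ L.map ((Int.castAddHom (ZMod 2)).compLeft ι) := by
  refine ⟨fun hx => ⟨x, hx, rfl⟩, ?_⟩
  rintro ⟨y, hy, hxy⟩
  have hd : x - y ∈ L := hE _ fun k => by
    have hk : (y k : ZMod 2) = x k := congrFun hxy k
    rw [← ZMod.intCast_eq_zero_iff_even]
    simp [hk]
  simpa using L.add_mem hd hy

open Classical in
lemma AddSubgroup.ncard_inter_box {ι : Type*} [Fintype ι] {L : AddSubgroup (ι → ℤ)}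
    (hE : ∀ x : ι → ℤ, (∀ k, Even (x k)) → x ∈ L) (s : ι → ℕ) (u : ι → ℤ) :
    Set.ncard {x : ι → ℤ | x ∈ L ∧ ∀ k, u k ≤ x k ∧ x k < u k + s k} =
      ∑ c : ι → ZMod 2 with c ∈ L.map ((Int.castAddHom (ZMod 2)).compLeft ι),
        ∏ k, ((if c k = (u k : ZMod 2) then s k % 2 else 0) + s k / 2) := by
  have hset : {x : ι → ℤ | x ∈ L ∧ ∀ k, u k ≤ x k ∧ x k < u k + s k} =
      ↑((Fintype.piFinset fun k => Finset.Ico (u k) (u k + s k)).filter (· ∈ L)) := by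
    ext x
    simp [and_comm]
  rw [hset, Set.ncard_coe_finset, Finset.card_eq_sum_card_fiberwise
    (f := fun x k => (x k : ZMod 2))
    (t := Finset.univ.filter (· ∈ L.map ((Int.castAddHom (ZMod 2)).compLeft ι)))
    fun x hx => by
      simpa only [Finset.coe_filter, Finset.mem_univ, true_and, Set.mem_ofPred_eq] using
        (mem_iff_cast_mem_map_zmod_two hE x).1 (Finset.mem_filter.1 hx).2]
  refine Finset.sum_congr rfl fun c hc => ?_
  simp_rw [← Int.card_Ico_filter_cast_zmod_two]
  rw [← Fintype.card_piFinset]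
  congr 1
  ext x
  have hx : (fun k => (x k : ZMod 2)) = c → x ∈ L := fun h =>
    (mem_iff_cast_mem_map_zmod_two hE x).2 (h ▸ (Finset.mem_filter.1 hc).2)
  simp only [Finset.mem_filter, Fintype.mem_piFinset, forall_and, ← funext_iff]
  tauto

/-- Theorem 1 (second part): among all translates of an integer box, the count of
points of a lattice `L` with `𝔼^p ⊆ L ⊆ ℤ^p` is maximized by the box anchored at
the origin; hence among all `L`-based designs with the same span vector `s`, the
maximal size is attained by a design containing the origin. -/
theorem stmt_1 (p : ℕ) (hp : 1 ≤ p) (L : AddSubgroup (Fin p → ℤ))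
    (hE : ∀ x : Fin p → ℤ, (∀ k, Even (x k)) → x ∈ L)
    (s : Fin p → ℕ) (hs : ∀ k, 1 ≤ s k) (u : Fin p → ℤ) :
    Set.ncard {x : Fin p → ℤ | x ∈ L ∧ ∀ k, u k ≤ x k ∧ x k < u k + s k} ≤
      Set.ncard {x : Fin p → ℤ | x ∈ L ∧ ∀ k, 0 ≤ x k ∧ x k < s k} := by
  classical
  have h0 := L.ncard_inter_box hE s 0
  simp only [Pi.zero_apply, zero_add, Int.cast_zero] at h0
  rw [L.ncard_inter_box hE s u, h0]
  convert AddSubgroup.sum_prod_add_ite_le (L.map ((Int.castAddHom (ZMod 2)).compLeft (Fin p)))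
    (fun k => s k / 2) (fun k => s k % 2) fun k => (u k : ZMod 2)
end

section
/- (Theorem 2, existence of an optimal standard form.) Fix p ≥ 1, an integer n ≥ 2, and positive weights w₁,…,w_p. Suppose D̄ = ((b̄ ⊗ L̄) ⊕ c̄) ∩ [0,1]^p is any interleaved-lattice-based design, where L̄ is a lattice with 𝔼^p ⊆ L̄ ⊆ ℤ^p, b̄ has positive entries, and |D̄| ≥ n. Then there exist a lattice L with 𝔼^p ⊆ L ⊆ ℤ^p such that for every k there is an x ∈ L with x_k = 1 (a standard interleaved lattice), and a vector s ∈ ℕ^p with every s_k ≥ 2, such that the design D(L,s) = (s−1_p)^{−1} ⊗ (L ∩ ∏_{k=1}^p {0,…,s_k−1}) satisfies |D(L,s)| ≥ n and ρ(D(L,s)) ≥ ρ(D̄). Hence the highest separation distance among all interleaved-lattice-based designs of size at least n is attained by a design of the form (5) with c = 0_p and b_k = 1/(s_k−1). -/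
/-- Among the translates of a lattice containing the even lattice, the lattice itself has the
most points in a box with a corner at the origin. -/
theorem ncard_translate_inter_box_le {ι : Type*} [Fintype ι] (L : AddSubgroup (ι → ℤ))
    (hE : ∀ x : ι → ℤ, (∀ k, Even (x k)) → x ∈ L) (s : ι → ℕ) (Z : Set (ι → ℤ))
    (hbox : ∀ x ∈ Z, ∀ k, 0 ≤ x k ∧ x k < s k) (hsub : ∀ x ∈ Z, ∀ y ∈ Z, x - y ∈ L) :
    Z.ncard ≤ {x : ι → ℤ | x ∈ L ∧ ∀ k, 0 ≤ x k ∧ x k < s k}.ncard := by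
  classical
  have hfin : {x : ι → ℤ | x ∈ L ∧ ∀ k, 0 ≤ x k ∧ x k < s k}.Finite :=
    (Set.finite_Icc (0 : ι → ℤ) (fun k => (s k : ℤ))).subset
      fun x hx => ⟨fun k => (hx.2 k).1, fun k => (hx.2 k).2.le⟩
  let block : (ι → ℤ) → ι → ℤ := fun x k => x k / 2
  let r := Function.invFunOn block Z
  have hrZ : ∀ x ∈ Z, r (block x) ∈ Z := fun x hx => Function.invFunOn_mem ⟨x, hx, rfl⟩
  have hr : ∀ x ∈ Z, ∀ k, r (block x) k / 2 = x k / 2 := fun x hx k =>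
    congrFun (Function.invFunOn_eq (f := block) (s := Z) ⟨x, hx, rfl⟩) k
  refine Set.ncard_le_ncard_of_injOn (fun x k => 2 * (x k / 2) + (x k - r (block x) k) % 2)
    ?_ ?_ hfin
  · intro x hx
    refine ⟨?_, fun k => ?_⟩
    · have h := L.add_mem (hsub x hx _ (hrZ x hx))
        (hE (fun k => 2 * (x k / 2) + (x k - r (block x) k) % 2 - (x k - r (block x) k))
          fun k => by rw [Int.even_iff]; omega)
      convert h using 1
      ext k
      simp
    · have h1 := hbox x hx k
      have h2 := hbox _ (hrZ x hx) k
      have h3 := hr x hx k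
      dsimp only
      omega
  · intro x hx y hy hxy
    have hblock : block x = block y := by
      ext k
      have := congrFun hxy k
      dsimp only [block] at this ⊢
      omega
    ext k
    have h1 := congrFun hxy k
    have h2 := congrFun hblock k
    dsimp only at h1
    rw [hblock] at h1
    dsimp only [block] at h1 h2
    omega

/-- If a translate of a lattice containing the even lattice meets both sides of a box, then
every nonzero lattice vector fitting in the box dominates the difference of two of its points. -/
theorem exists_pair_abs_sub_le {ι : Type*} (L : AddSubgroup (ι → ℤ))
    (hE : ∀ x : ι → ℤ, (∀ k, Even (x k)) → x ∈ L) (m M : ι → ℤ) (X : Set (ι → ℤ))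
    (hX : X = {x | x ∈ L ∧ ∀ k, m k ≤ x k ∧ x k ≤ M k}) (hne : X.Nonempty)
    (hm : ∀ k, ∃ x ∈ X, x k = m k) (f : ι → ℤ) (hf : f ∈ L) (hf0 : f ≠ 0)
    (hfM : ∀ k, |f k| ≤ M k - m k) :
    ∃ x ∈ X, ∃ y ∈ X, x ≠ y ∧ ∀ k, |x k - y k| ≤ |f k| := by
  classical
  by_cases h2 : ∃ k, 2 ≤ |f k|
  · obtain ⟨k, hk⟩ := h2
    obtain ⟨x, hx, hxk⟩ := hm k
    have hx' := hx
    rw [hX] at hx'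
    refine ⟨x, hx, x + Pi.single k 2, ?_, ?_, ?_⟩
    · rw [hX]
      refine ⟨L.add_mem hx'.1 (hE _ fun i => ?_), fun i => ?_⟩
      · by_cases hi : i = k
        · subst hi; simp
        · simp [hi]
      · by_cases hi : i = k
        · subst hi
          have := hfM i
          simp only [Pi.add_apply, Pi.single_eq_same]
          omega
        · simpa [hi] using hx'.2 i
    · intro h
      have := congrFun h k
      simp at this
    · intro i
      by_cases hi : i = k
      · subst hi; simpa using hk
      · simp [hi]
  · push Not at h2
    obtain ⟨x, hx⟩ := hne
    have hx' := hx
    rw [hX] at hx'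
    have habs : ∀ k, f k = 0 ∨ f k = 1 ∨ f k = -1 := fun k => by
      have := abs_lt.1 (h2 k)
      omega
    let d : ι → ℤ := fun k => if x k < M k then |f k| else -|f k|
    have hd : ∀ k, |d k| = |f k| := fun k => by
      dsimp only [d]; split_ifs <;> simp
    refine ⟨x, hx, x + d, ?_, ?_, ?_⟩
    · rw [hX]
      refine ⟨L.add_mem hx'.1 ?_, fun k => ?_⟩
      · have h := L.add_mem hf (hE (d - f) fun k => ?_)
        · simpa using h
        · dsimp only [d, Pi.sub_apply]
          rcases habs k with h | h | h <;> rw [h] <;> split_ifs <;> decide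
      · have h1 := hx'.2 k
        have h3 := hfM k
        dsimp only [d, Pi.add_apply]
        split_ifs <;> rcases habs k with h | h | h <;> rw [h] at h3 ⊢ <;>
          norm_num at h3 ⊢ <;> omega
    · intro h
      refine hf0 (funext fun k => ?_)
      have h3 := congrFun h k
      have h4 : d k = 0 := by simpa using h3
      have h5 := hd k
      rw [h4] at h5
      exact abs_eq_zero.1 (by simpa using h5.symm)
    · intro k
      simp [hd]

/-- Rescaling the coordinates of a lattice that contains the even lattice and tightly fills a
box `∏ [m k, M k]` yields a standard interleaved lattice and a span vector `s` with all entries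
at least `2`, with no fewer points in the box `∏ {0, …, s k - 1}`. -/
theorem exists_standard_lattice {ι : Type*} [Fintype ι] (L : AddSubgroup (ι → ℤ))
    (hE : ∀ x : ι → ℤ, (∀ k, Even (x k)) → x ∈ L) (m M : ι → ℤ) (X : Set (ι → ℤ))
    (hX : X = {x | x ∈ L ∧ ∀ k, m k ≤ x k ∧ x k ≤ M k}) (hnt : X.Nontrivial)
    (hm : ∀ k, ∃ x ∈ X, x k = m k) (hM : ∀ k, ∃ x ∈ X, x k = M k) :
    ∃ (L' : AddSubgroup (ι → ℤ)) (s : ι → ℕ) (g : ι → ℤ),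
      (∀ x : ι → ℤ, (∀ k, Even (x k)) → x ∈ L') ∧ (∀ k, ∃ x ∈ L', x k = 1) ∧
      (∀ k, 2 ≤ s k) ∧ (∀ k, g k * (s k - 1) = M k - m k) ∧
      X.ncard ≤ {x : ι → ℤ | x ∈ L' ∧ ∀ k, 0 ≤ x k ∧ x k < s k}.ncard ∧
      ∀ x ∈ L', ∀ y ∈ L', (∀ k, 0 ≤ x k ∧ x k < s k) → (∀ k, 0 ≤ y k ∧ y k < s k) → x ≠ y →
        ∃ x' ∈ X, ∃ y' ∈ X, x' ≠ y' ∧ ∀ k, |x' k - y' k| ≤ |g k * (x k - y k)| := by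
  classical
  have hXL : ∀ x ∈ X, x ∈ L := fun x hx => by rw [hX] at hx; exact hx.1
  have hXm : ∀ x ∈ X, ∀ k, m k ≤ x k ∧ x k ≤ M k := fun x hx => by rw [hX] at hx; exact hx.2
  obtain ⟨u, hu, v, hv, huv⟩ := hnt
  obtain ⟨j, hj⟩ : ∃ j, m j ≠ M j := by
    by_contra! h
    refine huv (funext fun k => ?_)
    have h1 := hXm u hu k
    have h2 := hXm v hv k
    have h3 := h k
    omega
  have hmM : ∀ k, m k ≤ M k := fun k => (hXm u hu k).1.trans (hXm u hu k).2
  let V : Set (ι → ℤ) := {e | e ∈ L ∧ ∀ k, m k = M k → e k = 0}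
  have hXV : ∀ x ∈ X, ∀ y ∈ X, x - y ∈ V := fun x hx y hy =>
    ⟨L.sub_mem (hXL x hx) (hXL y hy), fun k hk => by
      have h1 := hXm x hx k
      have h2 := hXm y hy k
      simp only [Pi.sub_apply]
      omega⟩
  let g : ι → ℤ := fun k => if m k = M k then 0 else if ∃ e ∈ V, Odd (e k) then 1 else 2
  have hgK : ∀ k, m k = M k → g k = 0 := fun k hk => by simp [g, hk]
  have hgpos : ∀ k, m k ≠ M k → 0 < g k := fun k hk => by
    simp only [g, hk, if_false]; split_ifs <;> norm_num
  have hgV : ∀ e ∈ V, ∀ k, g k ∣ e k := fun e he k => by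
    dsimp only [g]
    split_ifs with h1 h2
    · exact (zero_dvd_iff).2 (he.2 k h1)
    · exact one_dvd _
    · push Not at h2
      exact even_iff_two_dvd.1 (Int.not_odd_iff_even.1 (h2 e he))
  have hgX : ∀ x ∈ X, ∀ k, g k ∣ x k - m k := fun x hx k => by
    obtain ⟨y, hy, hyk⟩ := hm k
    rw [← hyk]
    exact hgV _ (hXV x hx y hy) k
  have hgM : ∀ k, g k ∣ M k - m k := fun k => by
    obtain ⟨y, hy, hyk⟩ := hM k
    rw [← hyk]
    exact hgX y hy k
  let L' : AddSubgroup (ι → ℤ) :=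
    { carrier := {x | (fun k => g k * x k) ∈ L ∧ ∀ k, m k = M k → Even (x k - x j)}
      zero_mem' := ⟨hE _ fun k => by simp, fun k _ => by simp⟩
      add_mem' := fun {a b} ha hb => by
        refine ⟨?_, fun k hk => ?_⟩
        · convert L.add_mem ha.1 hb.1 using 1
          ext k
          simp [mul_add]
        · simpa only [Pi.add_apply, add_sub_add_comm] using (ha.2 k hk).add (hb.2 k hk)
      neg_mem' := fun {a} ha => by
        refine ⟨?_, fun k hk => ?_⟩
        · convert L.neg_mem ha.1 using 1
          ext k
          simp
        · simpa only [Pi.neg_apply, neg_sub_neg, neg_sub] using (ha.2 k hk).neg }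
  have hE' : ∀ x : ι → ℤ, (∀ k, Even (x k)) → x ∈ L' := fun x hx =>
    ⟨hE _ fun k => (hx k).mul_left _, fun k _ => (hx k).sub (hx j)⟩
  have hlift : ∀ e ∈ V, ∃ x ∈ L', ∀ k, g k * x k = e k := fun e he => by
    choose q hq using hgV e he
    refine ⟨fun k => if m k = M k then q j else q k, ⟨?_, fun k hk => ?_⟩, fun k => ?_⟩
    · convert he.1 using 1
      ext k
      by_cases hk : m k = M k
      · simp [hgK k hk, he.2 k hk]
      · simp [hk, hq k]
    · simp [hk, hj]
    · by_cases hk : m k = M k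
      · simp [hgK k hk, he.2 k hk]
      · simp [hk, hq k]
  have hodd : ∀ k, m k ≠ M k → ∃ x ∈ L', Odd (x k) := fun k hk => by
    by_cases h : ∃ e ∈ V, Odd (e k)
    · obtain ⟨e, he, hek⟩ := h
      obtain ⟨x, hx, hxe⟩ := hlift e he
      refine ⟨x, hx, ?_⟩
      rw [← hxe k] at hek
      exact (Int.odd_mul.1 hek).2
    · have he : (Pi.single k 2 : ι → ℤ) ∈ V := by
        refine ⟨hE _ fun i => ?_, fun i hi => ?_⟩
        · by_cases hik : i = k
          · subst hik; simp
          · simp [hik]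
        · have : i ≠ k := by rintro rfl; exact hk hi
          simp [this]
      obtain ⟨x, hx, hxe⟩ := hlift _ he
      have hg : g k = 2 := by simp only [g, hk, h, if_false]
      have h1 := hxe k
      rw [hg, Pi.single_eq_same] at h1
      exact ⟨x, hx, by rw [show x k = 1 by omega]; exact odd_one⟩
  have hodd' : ∀ k, ∃ x ∈ L', Odd (x k) := fun k => by
    by_cases hk : m k = M k
    · obtain ⟨x, hx, hxj⟩ := hodd j hj
      refine ⟨x, hx, ?_⟩
      simpa using (hx.2 k hk).add_odd hxj
    · exact hodd k hk
  let s : ι → ℕ := fun k => if m k = M k then 2 else ((M k - m k) / g k).toNat + 1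
  have hsK : ∀ k, m k = M k → s k = 2 := fun k hk => by simp [s, hk]
  have hs : ∀ k, g k * (s k - 1) = M k - m k := fun k => by
    by_cases hk : m k = M k
    · simp [hgK k hk, hk]
    · have h0 : 0 ≤ (M k - m k) / g k :=
        Int.ediv_nonneg (sub_nonneg.2 (hmM k)) (hgpos k hk).le
      simp only [s, hk, if_false]
      push_cast
      rw [Int.toNat_of_nonneg h0, add_sub_cancel_right, Int.mul_ediv_cancel' (hgM k)]
  have hs2 : ∀ k, 2 ≤ s k := fun k => by
    by_cases hk : m k = M k
    · exact (hsK k hk).ge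
    · have h1 : 0 < g k * (s k - 1 : ℤ) := by
        have := hmM k
        rw [hs k]; omega
      have h2 := pos_of_mul_pos_right h1 (hgpos k hk).le
      omega
  refine ⟨L', s, g, hE', fun k => ?_, hs2, hs, ?_, ?_⟩
  · obtain ⟨x, hx, hxk⟩ := hodd' k
    refine ⟨x + Pi.single k (1 - x k), L'.add_mem hx (hE' _ fun i => ?_), by simp⟩
    by_cases hik : i = k
    · subst hik
      simpa using odd_one.sub_odd hxk
    · simp [hik]
  · have hq : ∀ x : ι → ℤ, ∃ q : ι → ℤ, x ∈ X → ∀ k, x k - m k = g k * q k := fun x => by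
      by_cases hx : x ∈ X
      · choose q hq using hgX x hx
        exact ⟨q, fun _ => hq⟩
      · exact ⟨0, fun h => absurd h hx⟩
    choose q hq using hq
    let z : (ι → ℤ) → ι → ℤ := fun x k => if m k = M k then q x j % 2 else q x k
    have hz : ∀ x ∈ X, ∀ k, x k - m k = g k * z x k := fun x hx k => by
      by_cases hk : m k = M k
      · have h1 := hXm x hx k
        rw [hgK k hk]
        omega
      · simp only [z, hk, if_false]
        exact hq x hx k
    have hinj : Set.InjOn z X := fun x hx y hy hxy => by
      ext k
      have h1 := hz x hx k
      rw [hxy, ← hz y hy k] at h1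
      omega
    rw [← hinj.ncard_image]
    refine ncard_translate_inter_box_le L' hE' s _ ?_ ?_
    · rintro _ ⟨x, hx, rfl⟩ k
      by_cases hk : m k = M k
      · rw [hsK k hk]
        simp only [z, hk, if_true]
        push_cast
        omega
      · have h1 := hXm x hx k
        have h2 := hz x hx k
        have h3 := hs k
        have h4 := hgpos k hk
        constructor
        · exact nonneg_of_mul_nonneg_right (a := g k) (by omega) h4
        · have : z x k ≤ s k - 1 := le_of_mul_le_mul_left (a := g k) (by omega) h4
          omega
    · rintro _ ⟨x, hx, rfl⟩ _ ⟨y, hy, rfl⟩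
      refine ⟨?_, fun k hk => ?_⟩
      · convert (hXV x hx y hy).1 using 1
        ext k
        have h1 := hz x hx k
        have h2 := hz y hy k
        simp only [Pi.sub_apply, mul_sub]
        omega
      · simp only [Pi.sub_apply, z, hk, hj, if_true, if_false]
        rw [Int.even_iff]
        omega
  · intro x hx y hy hxb hyb hxy
    have hsub := L'.sub_mem hx hy
    refine exists_pair_abs_sub_le L hE m M X hX ⟨u, hu⟩ hm (fun k => g k * (x k - y k))
      hsub.1 (fun h0 => ?_) (fun k => ?_)
    · have hoff : ∀ k, m k ≠ M k → x k - y k = 0 := fun k hk =>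
        (mul_eq_zero.1 (congrFun h0 k)).resolve_left (hgpos k hk).ne'
      refine hxy (funext fun k => ?_)
      by_cases hk : m k = M k
      · have h1 := hsub.2 k hk
        simp only [Pi.sub_apply, hoff j hj, sub_zero] at h1
        have h2 := hxb k
        have h3 := hyb k
        have h4 := hsK k hk
        rw [Int.even_iff] at h1
        omega
      · have := hoff k hk
        omega
    · have h2 := hxb k
      have h3 := hyb k
      have hg0 : 0 ≤ g k := by
        by_cases hk : m k = M k
        · exact (hgK k hk).ge
        · exact (hgpos k hk).le
      rw [← hs k, abs_mul, abs_of_nonneg hg0]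
      refine mul_le_mul_of_nonneg_left (abs_le.2 ?_) hg0
      omega


/-- The weighted `L²` separation distance of a set `D ⊆ ℝ^p`, with weights `w`:
the infimum of `d(x−y) = sqrt(Σ_k (w_k |x_k − y_k|)²)` over distinct pairs of
points of `D`. -/
noncomputable def sepDist {p : ℕ} (w : Fin p → ℝ) (D : Set (Fin p → ℝ)) : ℝ :=
  sInf {r : ℝ | ∃ x ∈ D, ∃ y ∈ D, x ≠ y ∧ r = Real.sqrt (∑ k, (w k * |x k - y k|) ^ 2)}

/-- Theorem 2 (existence of an optimal standard form): for any interleaved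
lattice-based design `D̄ = ((b̄ ⊗ L̄) ⊕ c̄) ∩ [0,1]^p` with at least `n ≥ 2`
points, there are a standard interleaved lattice `L` and a span vector `s` with
all `s_k ≥ 2` such that the design
`D(L,s) = (s−1_p)^{−1} ⊗ (L ∩ ∏_k {0,…,s_k−1})` has at least `n` points and
separation distance at least that of `D̄`. -/
theorem stmt_2 (p : ℕ) (hp : 1 ≤ p) (n : ℕ) (hn : 2 ≤ n)
    (w : Fin p → ℝ) (hw : ∀ k, 0 < w k)
    (Lbar : AddSubgroup (Fin p → ℤ))
    (hEbar : ∀ x : Fin p → ℤ, (∀ k, Even (x k)) → x ∈ Lbar)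
    (bbar cbar : Fin p → ℝ) (hbbar : ∀ k, 0 < bbar k)
    (Dbar : Set (Fin p → ℝ))
    (hDbar : Dbar =
      {y : Fin p → ℝ | (∃ x ∈ Lbar, ∀ k, y k = bbar k * (x k : ℝ) + cbar k) ∧
        ∀ k, 0 ≤ y k ∧ y k ≤ 1})
    (hcard : n ≤ Dbar.ncard) :
    ∃ (L : AddSubgroup (Fin p → ℤ)) (s : Fin p → ℕ),
      (∀ x : Fin p → ℤ, (∀ k, Even (x k)) → x ∈ L) ∧
      (∀ k, ∃ x ∈ L, x k = 1) ∧
      (∀ k, 2 ≤ s k) ∧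
      n ≤ Set.ncard {y : Fin p → ℝ | ∃ x ∈ L,
            (∀ k, (0 : ℤ) ≤ x k ∧ x k < s k) ∧
            ∀ k, y k = (x k : ℝ) / ((s k : ℝ) - 1)} ∧
      sepDist w Dbar ≤
        sepDist w {y : Fin p → ℝ | ∃ x ∈ L,
            (∀ k, (0 : ℤ) ≤ x k ∧ x k < s k) ∧
            ∀ k, y k = (x k : ℝ) / ((s k : ℝ) - 1)} := by
  let P : (Fin p → ℤ) → Fin p → ℝ := fun x k => bbar k * (x k : ℝ) + cbar k
  let X : Set (Fin p → ℤ) := {x | x ∈ Lbar ∧ ∀ k, 0 ≤ P x k ∧ P x k ≤ 1}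
  have hPinj : Function.Injective P := fun x y hxy => funext fun k => by
    have h := congrFun hxy k
    simpa [P, (hbbar k).ne'] using h
  have hDX : Dbar = P '' X := by
    rw [hDbar]
    ext y
    constructor
    · rintro ⟨⟨x, hx, hxy⟩, hy⟩
      obtain rfl : P x = y := funext fun k => (hxy k).symm
      exact ⟨x, ⟨hx, hy⟩, rfl⟩
    · rintro ⟨x, hx, rfl⟩
      exact ⟨⟨x, hx.1, fun k => rfl⟩, hx.2⟩
  have hXcard : n ≤ X.ncard := by
    rwa [hDX, Set.ncard_image_of_injective _ hPinj] at hcard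
  obtain ⟨hXnt, hXfin⟩ : X.Nontrivial ∧ X.Finite :=
    Set.one_lt_ncard_iff_nontrivial_and_finite.1 (by omega)
  choose a haX ha using fun k => Set.exists_min_image X (fun x => x k) hXfin hXnt.nonempty
  choose A hAX hA using fun k => Set.exists_max_image X (fun x => x k) hXfin hXnt.nonempty
  have hXbox : X = {x | x ∈ Lbar ∧ ∀ k, a k k ≤ x k ∧ x k ≤ A k k} := by
    ext x
    refine ⟨fun hx => ⟨hx.1, fun k => ⟨ha k x hx, hA k x hx⟩⟩, fun hx => ⟨hx.1, fun k => ?_⟩⟩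
    have h1 := ((haX k).2 k).1
    have h2 := ((hAX k).2 k).2
    have h3 : (a k k : ℝ) ≤ x k := by exact_mod_cast (hx.2 k).1
    have h4 : (x k : ℝ) ≤ A k k := by exact_mod_cast (hx.2 k).2
    have h5 := mul_le_mul_of_nonneg_left h3 (hbbar k).le
    have h6 := mul_le_mul_of_nonneg_left h4 (hbbar k).le
    dsimp only [P] at h1 h2 ⊢
    constructor <;> linarith
  obtain ⟨L, s, g, hE, hstd, hs2, hgs, hLcard, hpair⟩ :=
    exists_standard_lattice Lbar hEbar (fun k => a k k) (fun k => A k k) X hXbox hXnt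
      (fun k => ⟨a k, haX k, rfl⟩) (fun k => ⟨A k, hAX k, rfl⟩)
  let Q : (Fin p → ℤ) → Fin p → ℝ := fun x k => (x k : ℝ) / ((s k : ℝ) - 1)
  have hspos : ∀ k, (0 : ℝ) < (s k : ℝ) - 1 := fun k => by
    have : (2 : ℝ) ≤ s k := by exact_mod_cast hs2 k
    linarith
  have hQinj : Function.Injective Q := fun x y hxy => funext fun k => by
    have h := congrFun hxy k
    simpa [Q, div_left_inj' (hspos k).ne'] using h
  have hQ : {y : Fin p → ℝ | ∃ x ∈ L, (∀ k, (0 : ℤ) ≤ x k ∧ x k < s k) ∧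
      ∀ k, y k = (x k : ℝ) / ((s k : ℝ) - 1)} =
      Q '' {x | x ∈ L ∧ ∀ k, 0 ≤ x k ∧ x k < s k} := by
    ext y
    constructor
    · rintro ⟨x, hx, hxb, hxy⟩
      exact ⟨x, ⟨hx, hxb⟩, funext fun k => (hxy k).symm⟩
    · rintro ⟨x, hx, rfl⟩
      exact ⟨x, hx.1, hx.2, fun k => rfl⟩
  refine ⟨L, s, hE, hstd, hs2, ?_, ?_⟩
  · rw [hQ, Set.ncard_image_of_injective _ hQinj]
    exact hXcard.trans hLcard
  · rw [hQ, hDX]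
    refine le_csInf ?_ ?_
    · obtain ⟨x, hx, y, hy, hxy⟩ := (Set.one_lt_ncard_iff_nontrivial_and_finite.1
        (lt_of_lt_of_le (by omega : 1 < n) (hXcard.trans hLcard))).1
      exact ⟨_, Q x, ⟨x, hx, rfl⟩, Q y, ⟨y, hy, rfl⟩, hQinj.ne hxy, rfl⟩
    · rintro _ ⟨_, ⟨x, hx, rfl⟩, _, ⟨y, hy, rfl⟩, hxy, rfl⟩
      obtain ⟨x', hx', y', hy', hne, hle⟩ :=
        hpair x hx.1 y hy.1 hx.2 hy.2 fun h => hxy (congrArg Q h)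
      refine le_trans (csInf_le ⟨0, ?_⟩ (by exact ⟨P x', ⟨x', hx', rfl⟩, P y', ⟨y', hy', rfl⟩,
        hPinj.ne hne, rfl⟩)) (Real.sqrt_le_sqrt (Finset.sum_le_sum fun k _ => ?_))
      · rintro _ ⟨_, _, _, _, _, rfl⟩
        exact Real.sqrt_nonneg _
      · refine pow_le_pow_left₀ (mul_nonneg (hw k).le (abs_nonneg _))
          (mul_le_mul_of_nonneg_left ?_ (hw k).le) 2
        have h1 : |(x' k : ℝ) - y' k| ≤ |(g k : ℝ)| * |(x k : ℝ) - y k| := by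
          rw [← abs_mul]; exact_mod_cast hle k
        have h2 : (g k : ℝ) * ((s k : ℝ) - 1) = A k k - a k k := by exact_mod_cast hgs k
        have haA : (a k k : ℝ) ≤ A k k := by exact_mod_cast ha k _ (hAX k)
        have hg : (0 : ℝ) ≤ g k := nonneg_of_mul_nonneg_left (h2 ▸ sub_nonneg.2 haA) (hspos k)
        have h3 : bbar k * (g k * ((s k : ℝ) - 1)) ≤ 1 := by
          have h4 := ((haX k).2 k).1
          have h5 := ((hAX k).2 k).2
          dsimp only [P] at h4 h5
          rw [h2]
          linarith
        have hPsub : |P x' k - P y' k| = bbar k * |(x' k : ℝ) - y' k| := by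
          rw [← abs_of_pos (hbbar k), ← abs_mul]
          congr 1
          dsimp only [P]
          ring
        have hQsub : |Q x k - Q y k| = |(x k : ℝ) - y k| / ((s k : ℝ) - 1) := by
          dsimp only [Q]
          rw [← sub_div, abs_div, abs_of_pos (hspos k)]
        rw [abs_of_nonneg hg] at h1
        rw [hPsub, hQsub, le_div_iff₀ (hspos k)]
        calc bbar k * |(x' k : ℝ) - y' k| * ((s k : ℝ) - 1)
            ≤ bbar k * (g k * |(x k : ℝ) - y k|) * ((s k : ℝ) - 1) := by
              have := hspos k
              have := hbbar k
              gcongr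
          _ = bbar k * (g k * ((s k : ℝ) - 1)) * |(x k : ℝ) - y k| := by ring
          _ ≤ 1 * |(x k : ℝ) - y k| := mul_le_mul_of_nonneg_right h3 (abs_nonneg _)
          _ = |(x k : ℝ) - y k| := one_mul _
end

section
/- (Theorem 2, separation distance formula.) Let p ≥ 1, let L be a lattice with 𝔼^p ⊆ L ⊆ ℤ^p, let w₁,…,w_p > 0, and let s ∈ ℕ^p with every s_k ≥ 2. Let D = D(L,s) = (s−1_p)^{−1} ⊗ (L ∩ ∏_{k=1}^p {0,…,s_k−1}), and assume |D| ≥ 2. Then the separation distance of D equals ρ(D) = min[ min_{x ∈ L₀, x ≠ 0_p} d((s−1_p)^{−1} ⊗ x), min_{k: e_k ∈ L} w_k/(s_k−1), min_{k: s_k > 2} 2w_k/(s_k−1) ], where a minimum over an empty index set is interpreted as +∞. -/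
/-- A single coordinate bounds a weighted Euclidean length from below. -/
theorem abs_coord_le_sqrt_sum_sq {ι : Type*} [Fintype ι] (f : ι → ℝ) (k : ι) :
    |f k| ≤ Real.sqrt (∑ i, f i ^ 2) :=
  Real.abs_le_sqrt
    (Finset.single_le_sum (f := fun i => f i ^ 2) (fun i _ => sq_nonneg (f i)) (Finset.mem_univ k))

/-- The weighted Euclidean length of a multiple of a coordinate vector. -/
theorem sqrt_sum_sq_single {ι : Type*} [Fintype ι] [DecidableEq ι] (f : ι → ℝ) (k : ι)
    (hf : ∀ i, i ≠ k → f i = 0) (hk : 0 ≤ f k) :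
    Real.sqrt (∑ i, f i ^ 2) = f k := by
  rw [Finset.sum_eq_single k (fun i _ hi => by simp [hf i hi]) (by simp), Real.sqrt_sq hk]

/-- A real infimum of a nonempty set bounded below is the greatest lower bound in `EReal`. -/
theorem EReal.le_coe_csInf {S : Set ℝ} (hne : S.Nonempty) {m : EReal}
    (hm : ∀ r ∈ S, m ≤ (r : EReal)) : m ≤ ((sInf S : ℝ) : EReal) := by
  induction m with
  | bot => exact bot_le
  | coe a => exact EReal.coe_le_coe_iff.2 (le_csInf hne fun r hr => EReal.coe_le_coe_iff.1 (hm r hr))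
  | top =>
    obtain ⟨r, hr⟩ := hne
    exact absurd (top_le_iff.1 (hm r hr)) (EReal.coe_ne_top r)

/-- Taking absolute values of the coordinates preserves membership in a subgroup that contains
all even vectors. -/
theorem abs_mem_of_even_le {ι : Type*} (L : AddSubgroup (ι → ℤ))
    (hE : ∀ x : ι → ℤ, (∀ k, Even (x k)) → x ∈ L) {z : ι → ℤ} (hz : z ∈ L) :
    (fun k => |z k|) ∈ L := by
  have h : (fun k => |z k| - z k) ∈ L := hE _ fun k => by
    rcases abs_choice (z k) with h | h <;> rw [h]
    · simp
    · exact ⟨-z k, by ring⟩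
  convert L.add_mem h hz using 1
  ext k
  simp

/-- A difference vector in the lattice, nonzero and fitting in the box, satisfies one of the three
lower bounds of the separation distance formula. -/
theorem exists_short_vector_le {p : ℕ} (L : AddSubgroup (Fin p → ℤ))
    (hE : ∀ x : Fin p → ℤ, (∀ k, Even (x k)) → x ∈ L)
    (w : Fin p → ℝ) (hw : ∀ k, 0 < w k) (s : Fin p → ℕ) (hs : ∀ k, 2 ≤ s k)
    {z : Fin p → ℤ} (hz : z ∈ L) (hz0 : z ≠ 0) (hzs : ∀ k, |z k| < s k) :
    (∃ x : Fin p → ℤ, x ∈ L ∧ (∀ k, x k = 0 ∨ (x k = 1 ∧ Pi.single k (1 : ℤ) ∉ L)) ∧ x ≠ 0 ∧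
      Real.sqrt (∑ k, (w k * (|(x k : ℝ)| / ((s k : ℝ) - 1))) ^ 2) =
        Real.sqrt (∑ k, (w k * (|(z k : ℝ)| / ((s k : ℝ) - 1))) ^ 2)) ∨
    (∃ k, Pi.single k (1 : ℤ) ∈ L ∧ w k / ((s k : ℝ) - 1) ≤
      Real.sqrt (∑ k, (w k * (|(z k : ℝ)| / ((s k : ℝ) - 1))) ^ 2)) ∨
    (∃ k, 2 < s k ∧ 2 * w k / ((s k : ℝ) - 1) ≤
      Real.sqrt (∑ k, (w k * (|(z k : ℝ)| / ((s k : ℝ) - 1))) ^ 2)) := by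
  have hpos : ∀ k, (0 : ℝ) < (s k : ℝ) - 1 := fun k => by
    have : (2 : ℝ) ≤ s k := by exact_mod_cast hs k
    linarith
  have hcoord : ∀ (k : Fin p) (c : ℤ), c ≤ |z k| → (c : ℝ) * w k / ((s k : ℝ) - 1) ≤
      Real.sqrt (∑ k, (w k * (|(z k : ℝ)| / ((s k : ℝ) - 1))) ^ 2) := fun k c hc => by
    refine le_trans ?_ ((le_abs_self _).trans (abs_coord_le_sqrt_sum_sq
      (fun k => w k * (|(z k : ℝ)| / ((s k : ℝ) - 1))) k))
    have hc' : (c : ℝ) ≤ |(z k : ℝ)| := by exact_mod_cast hc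
    rw [← mul_div_assoc, mul_comm (w k)]
    have := hw k
    have := hpos k
    gcongr
  by_cases h2 : ∃ k, 2 ≤ |z k|
  · obtain ⟨k, hk⟩ := h2
    refine Or.inr (Or.inr ⟨k, ?_, by simpa using hcoord k 2 hk⟩)
    have := hzs k
    omega
  push Not at h2
  by_cases h1 : ∃ k, z k ≠ 0 ∧ Pi.single k (1 : ℤ) ∈ L
  · obtain ⟨k, hk, hkL⟩ := h1
    exact Or.inr (Or.inl ⟨k, hkL, by simpa using hcoord k 1 (Int.one_le_abs hk)⟩)
  push Not at h1
  refine Or.inl ⟨fun k => |z k|, abs_mem_of_even_le L hE hz, fun k => ?_, fun h => hz0 ?_, by simp⟩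
  · by_cases hk : z k = 0
    · simp [hk]
    · have := Int.one_le_abs hk
      have := h2 k
      exact Or.inr ⟨show |z k| = 1 by omega, h1 k hk⟩
  · ext k
    exact abs_eq_zero.1 (congrFun h k)

/-- Theorem 2 (separation distance formula): for a lattice `L` with
`𝔼^p ⊆ L ⊆ ℤ^p` and span vector `s` with all `s_k ≥ 2`, the separation
distance of `D(L,s) = (s−1_p)^{−1} ⊗ (L ∩ ∏_k {0,…,s_k−1})` equals
`min[ min_{x∈L₀, x≠0} d((s−1)^{−1}⊗x), min_{e_k∈L} w_k/(s_k−1),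
min_{s_k>2} 2w_k/(s_k−1) ]`, where minima over empty index sets are `+∞`
(the formula is stated in `EReal`, where `sInf ∅ = ⊤`). -/
theorem stmt_3 (p : ℕ) (hp : 1 ≤ p) (L : AddSubgroup (Fin p → ℤ))
    (hE : ∀ x : Fin p → ℤ, (∀ k, Even (x k)) → x ∈ L)
    (w : Fin p → ℝ) (hw : ∀ k, 0 < w k)
    (s : Fin p → ℕ) (hs : ∀ k, 2 ≤ s k)
    (D : Set (Fin p → ℝ))
    (hD : D = {y : Fin p → ℝ | ∃ x ∈ L,
        (∀ k, (0 : ℤ) ≤ x k ∧ x k < s k) ∧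
        ∀ k, y k = (x k : ℝ) / ((s k : ℝ) - 1)})
    (hD2 : 2 ≤ D.ncard) :
    ((sInf {r : ℝ | ∃ x ∈ D, ∃ y ∈ D, x ≠ y ∧
        r = Real.sqrt (∑ k, (w k * |x k - y k|) ^ 2)} : ℝ) : EReal) =
      min
        (sInf {r : EReal | ∃ x : Fin p → ℤ, x ∈ L ∧
          (∀ k, x k = 0 ∨ (x k = 1 ∧ Pi.single k (1 : ℤ) ∉ L)) ∧ x ≠ 0 ∧
          r = ((Real.sqrt (∑ k, (w k * (|(x k : ℝ)| / ((s k : ℝ) - 1))) ^ 2) : ℝ) : EReal)})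
        (min
          (sInf {r : EReal | ∃ k, Pi.single k (1 : ℤ) ∈ L ∧
            r = ((w k / ((s k : ℝ) - 1) : ℝ) : EReal)})
          (sInf {r : EReal | ∃ k, 2 < s k ∧
            r = ((2 * w k / ((s k : ℝ) - 1) : ℝ) : EReal)})) := by
  have hpos : ∀ k, (0 : ℝ) < (s k : ℝ) - 1 := fun k => by
    have : (2 : ℝ) ≤ s k := by exact_mod_cast hs k
    linarith
  set S := {r : ℝ | ∃ x ∈ D, ∃ y ∈ D, x ≠ y ∧ r = Real.sqrt (∑ k, (w k * |x k - y k|) ^ 2)}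
  have hbdd : BddBelow S := ⟨0, by
    rintro r ⟨x, _, y, _, _, rfl⟩
    exact Real.sqrt_nonneg _⟩
  have hle : ∀ x ∈ L, (∀ k, (0 : ℤ) ≤ x k ∧ x k < s k) → x ≠ 0 →
      sInf S ≤ Real.sqrt (∑ k, (w k * (|(x k : ℝ)| / ((s k : ℝ) - 1))) ^ 2) := by
    intro x hx hxs hx0
    refine csInf_le hbdd ⟨fun k => (x k : ℝ) / ((s k : ℝ) - 1), ?_, 0, ?_, fun h => hx0 ?_, ?_⟩
    · rw [hD]
      exact ⟨x, hx, hxs, fun k => rfl⟩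
    · rw [hD]
      exact ⟨0, L.zero_mem, fun k => ⟨le_rfl, by have := hs k; simp; omega⟩, fun k => by simp⟩
    · ext k
      have := congrFun h k
      simpa [(hpos k).ne'] using this
    · congr! 4 with k
      simp [abs_div, abs_of_pos (hpos k)]
  have hle_single : ∀ (k : Fin p) (c : ℤ), 0 < c → c < s k → Pi.single k c ∈ L →
      sInf S ≤ c * w k / ((s k : ℝ) - 1) := by
    intro k c hc hcs hcL
    refine (hle _ hcL (fun i => ?_) (by simpa using hc.ne')).trans_eq ?_
    · by_cases hi : i = k
      · subst hi
        simp [hc.le, hcs]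
      · have := hs i
        simp [hi]
        omega
    · have hc' : (0 : ℝ) < c := by exact_mod_cast hc
      have := hpos k
      have := hw k
      rw [sqrt_sum_sq_single _ k (fun i hi => by simp [hi]) (by positivity)]
      simp [abs_of_pos hc']
      ring
  refine le_antisymm (le_min ?_ (le_min ?_ ?_)) (EReal.le_coe_csInf ?_ ?_)
  · refine le_sInf ?_
    rintro _ ⟨x, hx, hx01, hx0, rfl⟩
    refine EReal.coe_le_coe_iff.2 (hle x hx (fun k => ?_) hx0)
    have := hs k
    rcases hx01 k with h | ⟨h, -⟩ <;> omega
  · refine le_sInf ?_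
    rintro _ ⟨k, hk, rfl⟩
    have := hs k
    exact EReal.coe_le_coe_iff.2 (by simpa using hle_single k 1 one_pos (by omega) hk)
  · refine le_sInf ?_
    rintro _ ⟨k, hk, rfl⟩
    have h2 : Pi.single k (2 : ℤ) ∈ L := hE _ fun i => by
      by_cases hi : i = k
      · subst hi
        simp
      · simp [hi]
    exact EReal.coe_le_coe_iff.2 (by simpa using hle_single k 2 two_pos (by omega) h2)
  · obtain ⟨x, hx, y, hy, hxy⟩ :=
      (Set.one_lt_ncard (Set.finite_of_ncard_pos (by omega))).1 (show 1 < D.ncard by omega)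
    exact ⟨_, x, hx, y, hy, hxy, rfl⟩
  · rintro _ ⟨x, hx, y, hy, hxy, rfl⟩
    rw [hD] at hx hy
    obtain ⟨a, haL, has, hax⟩ := hx
    obtain ⟨b, hbL, hbs, hby⟩ := hy
    have hdist : Real.sqrt (∑ k, (w k * |x k - y k|) ^ 2) =
        Real.sqrt (∑ k, (w k * (|((a - b) k : ℝ)| / ((s k : ℝ) - 1))) ^ 2) := by
      congr! 4 with k
      rw [hax, hby, ← sub_div, abs_div, abs_of_pos (hpos k)]
      simp
    rw [hdist]
    rcases exists_short_vector_le L hE w hw s hs (L.sub_mem haL hbL)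
      (sub_ne_zero.2 fun h => hxy (by ext k; rw [hax, hby, h]))
      (fun k => by
        have := has k
        have := hbs k
        rw [Pi.sub_apply, abs_lt]
        omega) with ⟨v, hvL, hv01, hv0, hv⟩ | ⟨k, hk, h⟩ | ⟨k, hk, h⟩
    · exact (min_le_left _ _).trans (sInf_le ⟨v, hvL, hv01, hv0, by rw [hv]⟩)
    · refine ((min_le_right _ _).trans (min_le_left _ _)).trans ?_
      exact sInf_le_of_le ⟨k, hk, rfl⟩ (EReal.coe_le_coe_iff.2 h)
    · refine ((min_le_right _ _).trans (min_le_right _ _)).trans ?_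
      exact sInf_le_of_le ⟨k, hk, rfl⟩ (EReal.coe_le_coe_iff.2 h)
end

section
/- (Theorem 3.) Let p ≥ 1 and let 0 ≤ z₁ ≤ z₂ < z₃ < p be integers. For every lattice L with 𝔼^p ⊆ L ⊆ ℤ^p, q(L) = z₃ and r(L) = z₁, there exists a lattice L̃ with 𝔼^p ⊆ L̃ ⊆ ℤ^p, q(L̃) = z₃ and r(L̃) = z₂ such that for every s ∈ ℕ^p, |L̃ ∩ ∏_{k=1}^p {0,…,s_k−1}| ≥ |L ∩ ∏_{k=1}^p {0,…,s_k−1}|. Consequently, for every s ∈ ℕ^p, max over lattices L with q(L)=z₃ and r(L)=z₂ of m(L,s) is at least max over lattices L with q(L)=z₃ and r(L)=z₁ of m(L,s), where m(L,s) = |L ∩ ∏_{k=1}^p {0,…,s_k−1}|. -/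
/-- The sublattice of `ℤ^p` of all vectors that lie in `L` once their `j`-th entry is set to `0`. -/
def zeroedAt {p : ℕ} (L : AddSubgroup (Fin p → ℤ)) (j : Fin p) : AddSubgroup (Fin p → ℤ) :=
  L.comap (AddMonoidHom.id _ -
    (AddMonoidHom.single (fun _ : Fin p => ℤ) j).comp (Pi.evalAddMonoidHom _ j))

theorem mem_zeroedAt {p : ℕ} {L : AddSubgroup (Fin p → ℤ)} {j : Fin p} {x : Fin p → ℤ} :
    x ∈ zeroedAt L j ↔ x - Pi.single j (x j) ∈ L := Iff.rfl

theorem mem_of_even_sub {p : ℕ} {L : AddSubgroup (Fin p → ℤ)}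
    (hE : ∀ x : Fin p → ℤ, (∀ k, Even (x k)) → x ∈ L) {x y : Fin p → ℤ}
    (hy : y ∈ L) (h : ∀ k, Even (x k - y k)) : x ∈ L := by
  have := L.add_mem (hE (x - y) h) hy
  rwa [sub_add_cancel] at this

theorem even_mem_zeroedAt {p : ℕ} {L : AddSubgroup (Fin p → ℤ)}
    (hE : ∀ x : Fin p → ℤ, (∀ k, Even (x k)) → x ∈ L) (j : Fin p)
    (x : Fin p → ℤ) (hx : ∀ k, Even (x k)) : x ∈ zeroedAt L j := by
  refine mem_zeroedAt.2 (hE _ fun k => ?_)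
  rcases eq_or_ne k j with rfl | hk
  · simp
  · simpa [hk] using hx k

theorem finite_box {p : ℕ} (L : AddSubgroup (Fin p → ℤ)) (s : Fin p → ℕ) :
    {x : Fin p → ℤ | x ∈ L ∧ ∀ k, 0 ≤ x k ∧ x k < s k}.Finite :=
  (Set.finite_Icc (0 : Fin p → ℤ) (fun k => (s k : ℤ))).subset
    fun _ hx => ⟨fun k => (hx.2 k).1, fun k => (hx.2 k).2.le⟩

theorem finite_binary {p : ℕ} (L : AddSubgroup (Fin p → ℤ)) :
    {x : Fin p → ℤ | x ∈ L ∧ ∀ k, x k = 0 ∨ x k = 1}.Finite :=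
  (finite_box L fun _ => 2).subset fun x hx => ⟨hx.1, fun k => by
    rcases hx.2 k with h | h <;> simp [h]⟩

theorem ncard_box_le_zeroedAt {p : ℕ} {L : AddSubgroup (Fin p → ℤ)}
    (hE : ∀ x : Fin p → ℤ, (∀ k, Even (x k)) → x ∈ L) (j : Fin p) (s : Fin p → ℕ) :
    Set.ncard {x : Fin p → ℤ | x ∈ L ∧ ∀ k, 0 ≤ x k ∧ x k < s k} ≤
      Set.ncard {x : Fin p → ℤ | x ∈ zeroedAt L j ∧ ∀ k, 0 ≤ x k ∧ x k < s k} := by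
  classical
  -- In each block of points with the same halves, translate the points with odd `j`-th entry
  -- by a representative `y` of them; the block is then mapped into itself.
  have key : ∀ t : Fin p → ℤ, ∃ y : Fin p → ℤ,
      ∀ x : Fin p → ℤ, x ∈ L → (∀ k, 0 ≤ x k ∧ x k < s k) → (∀ k, x k / 2 = t k) →
        x j % 2 = 1 →
        y ∈ L ∧ (∀ k, 0 ≤ y k ∧ y k < s k) ∧ (∀ k, y k / 2 = t k) ∧ y j % 2 = 1 := by
    intro t
    by_cases h : ∃ y : Fin p → ℤ,
        y ∈ L ∧ (∀ k, 0 ≤ y k ∧ y k < s k) ∧ (∀ k, y k / 2 = t k) ∧ y j % 2 = 1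
    · obtain ⟨y, hy⟩ := h
      exact ⟨y, fun _ _ _ _ _ => hy⟩
    · exact ⟨0, fun x h1 h2 h3 h4 => absurd ⟨x, h1, h2, h3, h4⟩ h⟩
  choose y hy using key
  let f : (Fin p → ℤ) → Fin p → ℤ := fun x k =>
    if x j % 2 = 1 ∧ k ≠ j then 2 * (x k / 2) + (x k - y (fun i => x i / 2) k) % 2 else x k
  have f_half : ∀ x k, f x k / 2 = x k / 2 := by
    intro x k
    simp only [f]
    split_ifs <;> omega
  have f_self : ∀ x, f x j = x j := fun x => by simp [f]
  refine Set.ncard_le_ncard_of_injOn f ?_ ?_ (finite_box _ s)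
  · rintro x ⟨hxL, hxs⟩
    by_cases hodd : x j % 2 = 1
    · obtain ⟨hyL, hys, hyt, hyj⟩ := hy (fun i => x i / 2) x hxL hxs (fun _ => rfl) hodd
      refine ⟨mem_zeroedAt.2 (mem_of_even_sub hE (L.sub_mem hxL hyL) fun k => ?_), fun k => ?_⟩
      · rw [Int.even_iff]
        rcases eq_or_ne k j with rfl | hk
        · simp only [Pi.sub_apply, Pi.single_eq_same]
          omega
        · simp only [Pi.sub_apply, Pi.single_eq_of_ne hk, f, hodd, ne_eq, hk, not_false_eq_true,
            and_self, if_true]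
          omega
      · have h1 := hxs k
        have h2 := hys k
        have h3 := hyt k
        simp only [f]
        split_ifs <;> omega
    · have hfx : f x = x := funext fun k => by simp [f, hodd]
      rw [hfx]
      refine ⟨mem_zeroedAt.2 (mem_of_even_sub hE hxL fun k => ?_), hxs⟩
      rw [Int.even_iff]
      rcases eq_or_ne k j with rfl | hk
      · simp only [Pi.sub_apply, Pi.single_eq_same]
        omega
      · simp [hk]
  · intro x _ x' _ hxx
    have half : (fun i => x i / 2) = fun i => x' i / 2 := funext fun i => by
      rw [← f_half x, ← f_half x', hxx]
    have hj : x j = x' j := by rw [← f_self x, ← f_self x', hxx]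
    funext k
    have hk := congrFun hxx k
    have hk2 := congrFun half k
    simp only [f, hj, half] at hk hk2
    split_ifs at hk <;> omega

theorem ncard_binary_zeroedAt {p : ℕ} {L : AddSubgroup (Fin p → ℤ)}
    (hE : ∀ x : Fin p → ℤ, (∀ k, Even (x k)) → x ∈ L) {j : Fin p}
    {c : Fin p → ℤ} (hc : c ∈ L) (hcj : Odd (c j)) :
    Set.ncard {x : Fin p → ℤ | x ∈ zeroedAt L j ∧ ∀ k, x k = 0 ∨ x k = 1} =
      Set.ncard {x : Fin p → ℤ | x ∈ L ∧ ∀ k, x k = 0 ∨ x k = 1} := by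
  -- The shear exchanging `e_j` and `c` modulo `2` is an involution on binary vectors.
  let g : (Fin p → ℤ) → Fin p → ℤ := fun x k =>
    (x k + x j * (c k - (Pi.single j (1 : ℤ) : Fin p → ℤ) k)) % 2
  have g_bin : ∀ x k, g x k = 0 ∨ g x k = 1 := fun x k => Int.emod_two_eq_zero_or_one _
  have g_self : ∀ x : Fin p → ℤ, (∀ k, x k = 0 ∨ x k = 1) → g x j = x j := by
    intro x hx
    have := Int.odd_iff.1 hcj
    rcases hx j with h | h <;> simp only [g, h, Pi.single_eq_same] <;> omega
  have g_inj : Set.InjOn g {x : Fin p → ℤ | ∀ k, x k = 0 ∨ x k = 1} := by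
    intro x hx x' hx' h
    have hj : x j = x' j := by rw [← g_self x hx, ← g_self x' hx', h]
    funext k
    have hk := congrFun h k
    have h1 := hx k
    have h2 := hx' k
    simp only [g, hj] at hk
    generalize x' j * _ = a at hk
    omega
  apply le_antisymm
  · refine Set.ncard_le_ncard_of_injOn g ?_ (g_inj.mono fun x hx => hx.2) (finite_binary _)
    rintro x ⟨hxL, hx⟩
    refine ⟨mem_of_even_sub hE (L.add_mem (mem_zeroedAt.1 hxL) (L.zsmul_mem hc (x j)))
      fun k => ?_, g_bin x⟩
    rw [Int.even_iff]
    rcases eq_or_ne k j with rfl | hk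
    · rcases hx k with h | h <;> simp [g, h]
    · rcases hx j with h | h <;> simp [g, h, hk]
  · refine Set.ncard_le_ncard_of_injOn g ?_ (g_inj.mono fun x hx => hx.2) (finite_binary _)
    rintro x ⟨hxL, hx⟩
    refine ⟨mem_zeroedAt.2 (mem_of_even_sub hE (L.add_mem hxL (L.zsmul_mem hc (x j)))
      fun k => ?_), g_bin x⟩
    rw [Int.even_iff]
    have := Int.odd_iff.1 hcj
    rcases eq_or_ne k j with rfl | hk
    · simp only [Pi.sub_apply, Pi.add_apply, Pi.smul_apply, Pi.single_eq_same, smul_eq_mul,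
        g_self x hx]
      rcases hx k with h | h <;> rw [h] <;> omega
    · rcases hx j with h | h <;> simp [g, h, hk]

theorem ncard_single_mem_zeroedAt {p : ℕ} {L : AddSubgroup (Fin p → ℤ)} {j : Fin p}
    (hj : Pi.single j (1 : ℤ) ∉ L) :
    Set.ncard {k : Fin p | Pi.single k (1 : ℤ) ∈ zeroedAt L j} =
      Set.ncard {k : Fin p | Pi.single k (1 : ℤ) ∈ L} + 1 := by
  rw [← Set.ncard_insert_of_notMem (show j ∉ {k : Fin p | Pi.single k (1 : ℤ) ∈ L} from hj)]
  congr 1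
  ext k
  rcases eq_or_ne k j with rfl | hk
  · simp [mem_zeroedAt]
  · simp [mem_zeroedAt, hk, hk.symm]

theorem exists_odd_of_ncard_single_lt {p : ℕ} {L : AddSubgroup (Fin p → ℤ)} {q : ℕ}
    (hq : Set.ncard {x : Fin p → ℤ | x ∈ L ∧ ∀ k, x k = 0 ∨ x k = 1} = 2 ^ q)
    (hr : Set.ncard {k : Fin p | Pi.single k (1 : ℤ) ∈ L} < q) :
    ∃ j, Pi.single j (1 : ℤ) ∉ L ∧ ∃ c ∈ L, Odd (c j) := by
  by_contra! h
  have hle : Set.ncard {x : Fin p → ℤ | x ∈ L ∧ ∀ k, x k = 0 ∨ x k = 1} ≤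
      Set.ncard (𝒫 {k : Fin p | Pi.single k (1 : ℤ) ∈ L}) := by
    refine Set.ncard_le_ncard_of_injOn (fun x => {k | x k = 1}) ?_ ?_ (Set.toFinite _)
    · rintro x ⟨hxL, -⟩ k (hk : x k = 1)
      by_contra hkL
      exact h k hkL x hxL (by simp [hk])
    · rintro x ⟨-, hx⟩ x' ⟨-, hx'⟩ hxx
      funext k
      have hk : x k = 1 ↔ x' k = 1 := Set.ext_iff.1 hxx k
      have h1 := hx k
      have h2 := hx' k
      omega
  rw [hq, Set.ncard_powerset] at hle
  exact absurd ((Nat.pow_le_pow_iff_right (by norm_num)).1 hle) hr.not_ge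

/-- Theorem 3: if `L` is a lattice with `𝔼^p ⊆ L ⊆ ℤ^p`, `q(L) = z₃` and
`r(L) = z₁` with `0 ≤ z₁ ≤ z₂ < z₃ < p`, then there is a lattice `L̃` with
`𝔼^p ⊆ L̃ ⊆ ℤ^p`, `q(L̃) = z₃`, `r(L̃) = z₂` such that for every span vector
`s`, `L̃` has at least as many points as `L` in the box `∏_k {0,…,s_k−1}`;
consequently `max_{q=z₃, r=z₂} m(L,s) ≥ max_{q=z₃, r=z₁} m(L,s)`. -/
theorem stmt_4 (p : ℕ) (hp : 1 ≤ p) (z1 z2 z3 : ℕ)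
    (h12 : z1 ≤ z2) (h23 : z2 < z3) (h3p : z3 < p)
    (L : AddSubgroup (Fin p → ℤ))
    (hE : ∀ x : Fin p → ℤ, (∀ k, Even (x k)) → x ∈ L)
    (hq : Set.ncard {x : Fin p → ℤ | x ∈ L ∧ ∀ k, x k = 0 ∨ x k = 1} = 2 ^ z3)
    (hr : Set.ncard {k : Fin p | Pi.single k (1 : ℤ) ∈ L} = z1) :
    ∃ Lt : AddSubgroup (Fin p → ℤ),
      (∀ x : Fin p → ℤ, (∀ k, Even (x k)) → x ∈ Lt) ∧
      Set.ncard {x : Fin p → ℤ | x ∈ Lt ∧ ∀ k, x k = 0 ∨ x k = 1} = 2 ^ z3 ∧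
      Set.ncard {k : Fin p | Pi.single k (1 : ℤ) ∈ Lt} = z2 ∧
      ∀ s : Fin p → ℕ,
        Set.ncard {x : Fin p → ℤ | x ∈ L ∧ ∀ k, 0 ≤ x k ∧ x k < s k} ≤
          Set.ncard {x : Fin p → ℤ | x ∈ Lt ∧ ∀ k, 0 ≤ x k ∧ x k < s k} := by
  induction z2, h12 using Nat.le_induction with
  | base => exact ⟨L, hE, hq, hr, fun _ => le_rfl⟩
  | succ n _ ih =>
    obtain ⟨M, hME, hMq, hMr, hM⟩ := ih (by omega)
    obtain ⟨j, hj, c, hc, hcj⟩ := exists_odd_of_ncard_single_lt hMq (by omega)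
    exact ⟨zeroedAt M j, even_mem_zeroedAt hME j, (ncard_binary_zeroedAt hME hc hcj).trans hMq,
      by rw [ncard_single_mem_zeroedAt hj, hMr],
      fun s => (hM s).trans (ncard_box_le_zeroedAt hME j s)⟩
end

section
/- Let p ≥ 1 and let L be a lattice with 𝔼^p ⊆ L ⊆ ℤ^p. Then |L₀| · 2^{r(L)} = 2^{q(L)}, i.e., the cardinality of L₀ = {x ∈ L : for every k, x_k = 0 or (x_k = 1 and e_k ∉ L)} times 2 raised to the number of unit vectors contained in L equals the cardinality of L ∩ {0,1}^p. -/
/-- An additive subgroup of `ι → ℤ` contains every vector supported on coordinates whose unit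
vectors it contains. -/
theorem AddSubgroup.indicator_mem_of_single_mem {ι : Type*} [Fintype ι] [DecidableEq ι]
    (L : AddSubgroup (ι → ℤ)) {T : Set ι} (hT : ∀ k ∈ T, Pi.single k (1 : ℤ) ∈ L) (y : ι → ℤ) :
    T.indicator y ∈ L := by
  rw [← Finset.univ_sum_single (T.indicator y)]
  refine L.sum_mem fun k _ => ?_
  by_cases hk : k ∈ T
  · have h : Pi.single k (T.indicator y k) = y k • (Pi.single k (1 : ℤ) : ι → ℤ) := by
      rw [← Pi.single_smul]
      simp [hk]
    rw [h]
    exact L.zsmul_mem (hT k hk) _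
  · simp [hk, L.zero_mem]

/-- For a lattice `L` with `𝔼^p ⊆ L ⊆ ℤ^p`, `|L₀| · 2^{r(L)} = 2^{q(L)}`:
the cardinality of `L₀ = {x ∈ L : ∀ k, x_k = 0 ∨ (x_k = 1 ∧ e_k ∉ L)}` times
`2` raised to the number of unit vectors contained in `L` equals the
cardinality of `L ∩ {0,1}^p`. -/
theorem stmt_6 (p : ℕ) (hp : 1 ≤ p) (L : AddSubgroup (Fin p → ℤ))
    (hE : ∀ x : Fin p → ℤ, (∀ k, Even (x k)) → x ∈ L) :
    Set.ncard {x : Fin p → ℤ | x ∈ L ∧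
        ∀ k, x k = 0 ∨ (x k = 1 ∧ Pi.single k (1 : ℤ) ∉ L)} *
      2 ^ Set.ncard {k : Fin p | Pi.single k (1 : ℤ) ∈ L} =
    Set.ncard {x : Fin p → ℤ | x ∈ L ∧ ∀ k, x k = 0 ∨ x k = 1} := by
  set R : Set (Fin p) := {k | Pi.single k (1 : ℤ) ∈ L}
  set L₀ : Set (Fin p → ℤ) :=
    {x | x ∈ L ∧ ∀ k, x k = 0 ∨ (x k = 1 ∧ Pi.single k (1 : ℤ) ∉ L)}
  let f : (Fin p → ℤ) × Set (Fin p) → Fin p → ℤ := fun z => z.1 + z.2.indicator 1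
  have eq_zero : ∀ x ∈ L₀, ∀ k ∈ R, x k = 0 := fun x hx k hk =>
    (hx.2 k).resolve_right fun h => h.2 hk
  have f_inj : Set.InjOn f (L₀ ×ˢ 𝒫 R) := by
    rintro ⟨x, T⟩ ⟨hx, hT⟩ ⟨y, U⟩ ⟨hy, hU⟩ h
    have h' : ∀ k, x k + T.indicator 1 k = y k + U.indicator 1 k := fun k => congrFun h k
    have hTU : T = U := by
      ext k
      by_cases hk : k ∈ R
      · have hk' := h' k
        rw [eq_zero x hx k hk, eq_zero y hy k hk] at hk'
        by_cases h₁ : k ∈ T <;> by_cases h₂ : k ∈ U <;> simp_all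
      · exact iff_of_false (fun h => hk (hT h)) (fun h => hk (hU h))
    subst hTU
    exact Prod.ext (funext fun k => add_right_cancel (h' k)) rfl
  have f_image : f '' (L₀ ×ˢ 𝒫 R) = {x | x ∈ L ∧ ∀ k, x k = 0 ∨ x k = 1} := by
    ext y
    constructor
    · rintro ⟨⟨x, T⟩, ⟨hx, hT⟩, rfl⟩
      refine ⟨L.add_mem hx.1 (L.indicator_mem_of_single_mem (fun k hk => hT hk) 1), fun k => ?_⟩
      by_cases hk : k ∈ T
      · right
        simp [f, hk, eq_zero x hx k (hT hk)]
      · simpa [f, hk] using (hx.2 k).imp_right And.left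
    · rintro ⟨hy, hy01⟩
      refine ⟨(y - R.indicator y, {k | k ∈ R ∧ y k = 1}), ⟨⟨?_, fun k => ?_⟩, fun k hk => hk.1⟩, ?_⟩
      · exact L.sub_mem hy (L.indicator_mem_of_single_mem (fun k hk => hk) y)
      · by_cases hk : k ∈ R
        · left
          simp [hk]
        · have hk' : Pi.single k (1 : ℤ) ∉ L := hk
          simpa [hk, hk'] using hy01 k
      · funext k
        by_cases hk : k ∈ R
        · rcases hy01 k with h | h <;> simp [f, Set.indicator, hk, h]
        · simp [f, Set.indicator, hk]
  rw [← f_image, f_inj.ncard_image, Set.ncard_prod, Set.ncard_powerset]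
end

section
/- Let p ≥ 1 and let L be a lattice with 𝔼^p ⊆ L ⊆ ℤ^p. Then for every u ∈ ℤ^p and every z ∈ ℕ^p with z_k ≥ 1 for all k and z_k even for every k with e_k ∉ L, the number of lattice points in the box satisfies |L ∩ ∏_{k=1}^p {u_k, u_k+1, …, u_k+z_k−1}| = |L₀| · ∏_{k: e_k ∉ L} (z_k/2) · ∏_{k: e_k ∈ L} z_k. -/
/-- If a subgroup `L` of `ι → ℤ` contains all even vectors, then it contains every vector whose
odd coordinates are at indices `k` with `e_k ∈ L`. -/
theorem AddSubgroup.mem_of_forall_even_or_single_mem {ι : Type*} [Fintype ι] [DecidableEq ι]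
    {L : AddSubgroup (ι → ℤ)} (hE : ∀ x : ι → ℤ, (∀ k, Even (x k)) → x ∈ L)
    {w : ι → ℤ} (hw : ∀ k, Even (w k) ∨ Pi.single k (1 : ℤ) ∈ L) : w ∈ L := by
  rw [← Finset.univ_sum_single w]
  refine L.sum_mem fun k _ => ?_
  rcases hw k with h | h
  · refine hE _ fun j => ?_
    rcases eq_or_ne j k with rfl | hj
    · simpa using h
    · simp [hj]
  · have : Pi.single k (w k) = w k • (Pi.single k (1 : ℤ) : ι → ℤ) := by
      rw [← Pi.single_smul]; simp
    rw [this]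
    exact L.zsmul_mem h _

open Classical in
/-- The point of the box with corner `u` in the class of `r` modulo even vectors and the unit
vectors of `L`, at position `q` among the points of that class, where `a = (r, q)`. -/
noncomputable def boxPoint {ι : Type*} [DecidableEq ι] (L : AddSubgroup (ι → ℤ)) (u : ι → ℤ)
    (a : (ι → ℤ) × (ι → ℕ)) (k : ι) : ℤ :=
  if Pi.single k (1 : ℤ) ∈ L then u k + a.2 k else u k + 2 * a.2 k + (a.1 k - u k) % 2

open Classical in
/-- For a lattice `L` with `𝔼^p ⊆ L ⊆ ℤ^p` and a box with side lengths `z_k ≥ 1`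
which are even whenever `e_k ∉ L`, the number of lattice points in the box is
`|L₀| · ∏_{k: e_k∉L} (z_k/2) · ∏_{k: e_k∈L} z_k`. -/
theorem stmt_7 (p : ℕ) (hp : 1 ≤ p) (L : AddSubgroup (Fin p → ℤ))
    (hE : ∀ x : Fin p → ℤ, (∀ k, Even (x k)) → x ∈ L)
    (u : Fin p → ℤ) (z : Fin p → ℕ) (hz : ∀ k, 1 ≤ z k)
    (hzeven : ∀ k, Pi.single k (1 : ℤ) ∉ L → Even (z k)) :
    Set.ncard {x : Fin p → ℤ | x ∈ L ∧ ∀ k, u k ≤ x k ∧ x k < u k + z k} =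
      Set.ncard {x : Fin p → ℤ | x ∈ L ∧
          ∀ k, x k = 0 ∨ (x k = 1 ∧ Pi.single k (1 : ℤ) ∉ L)} *
        (∏ k ∈ Finset.univ.filter fun k => Pi.single k (1 : ℤ) ∉ L, z k / 2) *
        (∏ k ∈ Finset.univ.filter fun k => Pi.single k (1 : ℤ) ∈ L, z k) := by
  set S : Set (Fin p → ℤ) :=
    {x | x ∈ L ∧ ∀ k, x k = 0 ∨ (x k = 1 ∧ Pi.single k (1 : ℤ) ∉ L)}
  set T : Finset (Fin p → ℕ) := Fintype.piFinset fun k =>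
    Finset.range (if Pi.single k (1 : ℤ) ∈ L then z k else z k / 2) with hT
  have hTcard : T.card = (∏ k ∈ Finset.univ.filter fun k => Pi.single k (1 : ℤ) ∉ L, z k / 2) *
      (∏ k ∈ Finset.univ.filter fun k => Pi.single k (1 : ℤ) ∈ L, z k) := by
    rw [hT, Fintype.card_piFinset]
    simp only [Finset.card_range]
    rw [Finset.prod_ite, mul_comm]
  have hbox : {x : Fin p → ℤ | x ∈ L ∧ ∀ k, u k ≤ x k ∧ x k < u k + z k} =
      boxPoint L u '' (S ×ˢ (T : Set (Fin p → ℕ))) := by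
    ext x
    constructor
    · rintro ⟨hxL, hx⟩
      refine ⟨(fun k => if Pi.single k (1 : ℤ) ∈ L then 0 else x k % 2,
        fun k => if Pi.single k (1 : ℤ) ∈ L then (x k - u k).toNat
          else ((x k - u k) / 2).toNat), ⟨⟨?_, fun k => ?_⟩, ?_⟩, ?_⟩
      · rw [← sub_sub_cancel x (fun k => if Pi.single k (1 : ℤ) ∈ L then 0 else x k % 2)]
        refine L.sub_mem hxL (AddSubgroup.mem_of_forall_even_or_single_mem hE fun k => ?_)
        by_cases h : Pi.single k (1 : ℤ) ∈ L
        · exact Or.inr h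
        · left
          simp only [Pi.sub_apply, if_neg h, Int.even_iff]
          omega
      · by_cases h : Pi.single k (1 : ℤ) ∈ L
        · simp [h]
        · simp only [h, not_false_eq_true, and_true]
          omega
      · simp only [hT, Finset.mem_coe, Fintype.mem_piFinset, Finset.mem_range]
        intro k
        have := hx k
        by_cases h : Pi.single k (1 : ℤ) ∈ L
        · simp only [if_pos h]
          omega
        · have := Nat.even_iff.mp (hzeven k h)
          simp only [if_neg h]
          omega
      · funext k
        have := hx k
        by_cases h : Pi.single k (1 : ℤ) ∈ L
        · simp only [boxPoint, if_pos h]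
          omega
        · simp only [boxPoint, if_neg h]
          omega
    · rintro ⟨⟨r, q⟩, ⟨⟨hrL, hr⟩, hq⟩, rfl⟩
      simp only [hT, Finset.mem_coe, Fintype.mem_piFinset, Finset.mem_range] at hq
      refine ⟨?_, fun k => ?_⟩
      · rw [← sub_add_cancel (boxPoint L u (r, q)) r]
        refine L.add_mem (AddSubgroup.mem_of_forall_even_or_single_mem hE fun k => ?_) hrL
        by_cases h : Pi.single k (1 : ℤ) ∈ L
        · exact Or.inr h
        · left
          simp only [Pi.sub_apply, boxPoint, if_neg h, Int.even_iff]
          omega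
      · have := hq k
        by_cases h : Pi.single k (1 : ℤ) ∈ L
        · simp only [boxPoint, if_pos h] at this ⊢
          omega
        · simp only [boxPoint, if_neg h] at this ⊢
          omega
  have hinj : Set.InjOn (boxPoint L u) (S ×ˢ (T : Set (Fin p → ℕ))) := by
    rintro ⟨r, q⟩ ⟨⟨-, hr⟩, -⟩ ⟨r', q'⟩ ⟨⟨-, hr'⟩, -⟩ heq
    have key : ∀ k, r k = r' k ∧ q k = q' k := fun k => by
      have hk := congrFun heq k
      have h₁ := hr k
      have h₂ := hr' k
      by_cases h : Pi.single k (1 : ℤ) ∈ L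
      · simp only [h, not_true_eq_false, and_false, or_false] at h₁ h₂
        simp only [boxPoint, if_pos h] at hk
        omega
      · simp only [h, not_false_eq_true, and_true] at h₁ h₂
        simp only [boxPoint, if_neg h] at hk
        omega
    exact Prod.ext (funext fun k => (key k).1) (funext fun k => (key k).2)
  rw [hbox, hinj.ncard_image, Set.ncard_prod, Set.ncard_coe_finset, hTcard, mul_assoc]
end

section
/- Let p ≥ 1, let L be a lattice with 𝔼^p ⊆ L ⊆ ℤ^p, let w₁,…,w_p > 0, let b be a p-vector with positive entries, and let s ∈ ℕ^p with every s_k ≥ 2. Then for any two distinct points y, z ∈ L ∩ ∏_{k=1}^p {0,…,s_k−1}, the weighted distance satisfies d(b ⊗ (z−y)) ≥ min[ min_{x ∈ L₀, x ≠ 0_p} d(b ⊗ x), min_{k: e_k ∈ L} b_k w_k, min_{k: s_k > 2} 2 b_k w_k ], where a minimum over an empty index set is +∞. (This is the lower-bound half of the separation-distance formula in Theorem 2.) -/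
/-- A lower bound on a single coordinate gives a lower bound on the weighted length. -/
theorem mul_le_sqrt_sum_sq_of_le_abs {p : ℕ} {w b : Fin p → ℝ} (hw : ∀ k, 0 < w k)
    (hb : ∀ k, 0 < b k) (v : Fin p → ℝ) (k : Fin p) {c : ℝ} (hc : c ≤ |v k|) :
    c * (b k * w k) ≤ Real.sqrt (∑ i, (w i * (b i * |v i|)) ^ 2) := by
  have hbw : 0 < b k * w k := mul_pos (hb k) (hw k)
  calc c * (b k * w k) ≤ |v k| * (b k * w k) := by gcongr
    _ = w k * (b k * |v k|) := by ring
    _ ≤ Real.sqrt (∑ i, (w i * (b i * |v i|)) ^ 2) := by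
      apply Real.le_sqrt_of_sq_le
      exact Finset.single_le_sum (f := fun i => (w i * (b i * |v i|)) ^ 2)
        (fun i _ => sq_nonneg _) (Finset.mem_univ k)


/-- Lower-bound half of the separation-distance formula of Theorem 2: for any
two distinct points `y, z` of `L ∩ ∏_k {0,…,s_k−1}`, the weighted distance
`d(b ⊗ (z−y))` is at least
`min[ min_{x∈L₀, x≠0} d(b⊗x), min_{k: e_k∈L} b_k w_k, min_{k: s_k>2} 2 b_k w_k ]`,
where minima over empty index sets are `+∞` (stated in `EReal`, where
`sInf ∅ = ⊤`). -/
theorem stmt_11 (p : ℕ) (hp : 1 ≤ p) (L : AddSubgroup (Fin p → ℤ))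
    (hE : ∀ x : Fin p → ℤ, (∀ k, Even (x k)) → x ∈ L)
    (w : Fin p → ℝ) (hw : ∀ k, 0 < w k)
    (b : Fin p → ℝ) (hb : ∀ k, 0 < b k)
    (s : Fin p → ℕ) (hs : ∀ k, 2 ≤ s k)
    (y z : Fin p → ℤ) (hy : y ∈ L) (hz : z ∈ L)
    (hybox : ∀ k, 0 ≤ y k ∧ y k < s k) (hzbox : ∀ k, 0 ≤ z k ∧ z k < s k)
    (hne : y ≠ z) :
    min
      (sInf {r : EReal | ∃ x : Fin p → ℤ, x ∈ L ∧
        (∀ k, x k = 0 ∨ (x k = 1 ∧ Pi.single k (1 : ℤ) ∉ L)) ∧ x ≠ 0 ∧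
        r = ((Real.sqrt (∑ k, (w k * (b k * |(x k : ℝ)|)) ^ 2) : ℝ) : EReal)})
      (min
        (sInf {r : EReal | ∃ k, Pi.single k (1 : ℤ) ∈ L ∧
          r = ((b k * w k : ℝ) : EReal)})
        (sInf {r : EReal | ∃ k, 2 < s k ∧
          r = ((2 * (b k * w k) : ℝ) : EReal)})) ≤
      ((Real.sqrt (∑ k, (w k * (b k * |((z k : ℝ) - (y k : ℝ))|)) ^ 2) : ℝ) : EReal) := by
  by_cases hbig : ∃ k, 2 ≤ |z k - y k|
  · obtain ⟨k, hk⟩ := hbig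
    have hsk : 2 < s k := by
      have h₁ := hybox k
      have h₂ := hzbox k
      rcases le_abs.mp hk with h | h <;> omega
    refine min_le_of_right_le (min_le_of_right_le
      (sInf_le_of_le ⟨k, hsk, rfl⟩ (EReal.coe_le_coe_iff.mpr ?_)))
    exact mul_le_sqrt_sum_sq_of_le_abs hw hb (fun i => (z i : ℝ) - y i) k (by exact_mod_cast hk)
  by_cases hunit : ∃ k, z k ≠ y k ∧ Pi.single k (1 : ℤ) ∈ L
  · obtain ⟨k, hk, hL⟩ := hunit
    refine min_le_of_right_le (min_le_of_left_le
      (sInf_le_of_le ⟨k, hL, rfl⟩ (EReal.coe_le_coe_iff.mpr ?_)))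
    have h₁ : 1 ≤ |z k - y k| := Int.one_le_abs (sub_ne_zero.mpr hk)
    simpa using mul_le_sqrt_sum_sq_of_le_abs hw hb (fun i => (z i : ℝ) - y i) k (c := 1)
      (by exact_mod_cast h₁)
  push Not at hbig hunit
  refine (min_le_left _ _).trans (sInf_le ⟨fun k => |z k - y k|, ?_, fun k => ?_, ?_, ?_⟩)
  · have hdiff : (fun k => |z k - y k|) - (z - y) ∈ L := hE _ fun k => by
      simp only [Pi.sub_apply]
      rcases abs_choice (z k - y k) with h | h <;> rw [h]
      · simp
      · exact ⟨-(z k - y k), by ring⟩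
    simpa using L.add_mem hdiff (L.sub_mem hz hy)
  · by_cases h : z k = y k
    · left
      simp [h]
    · right
      have h₁ : 1 ≤ |z k - y k| := Int.one_le_abs (sub_ne_zero.mpr h)
      exact ⟨le_antisymm (Int.lt_add_one_iff.mp (hbig k)) h₁, hunit k h⟩
  · intro h
    refine hne (funext fun k => ?_)
    have hk : |z k - y k| = 0 := congrFun h k
    exact (sub_eq_zero.mp (abs_eq_zero.mp hk)).symm
  · simp
end

section
/- Let p ≥ 1 and let L be a standard interleaved lattice, i.e., a lattice with 𝔼^p ⊆ L ⊆ ℤ^p such that for every k ∈ {1,…,p} there exists x ∈ L with x_k = 1. Let b be a p-vector with positive entries and c a p-vector such that for every k, ⌊(1−c_k)/b_k⌋ ≥ ⌈−c_k/b_k⌉ + 1. Then for each k, the number s_k of distinct values of the k-th coordinate among points of the design D = ((b ⊗ L) ⊕ c) ∩ [0,1]^p equals s_k = ⌊(1−c_k)/b_k⌋ − ⌈−c_k/b_k⌉ + 1. -/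
theorem affine_mem_unit_interval_iff {b c : ℝ} (hb : 0 < b) (z : ℤ) :
    (0 ≤ b * (z : ℝ) + c ∧ b * (z : ℝ) + c ≤ 1) ↔ ⌈-c / b⌉ ≤ z ∧ z ≤ ⌊(1 - c) / b⌋ := by
  rw [Int.ceil_le, Int.le_floor, div_le_iff₀ hb, le_div_iff₀ hb, mul_comm (z : ℝ) b]
  constructor <;> rintro ⟨h₁, h₂⟩ <;> constructor <;> linarith

theorem exists_mem_lattice_of_coord {ι : Type*} (L : AddSubgroup (ι → ℤ))
    (hE : ∀ x : ι → ℤ, (∀ k, Even (x k)) → x ∈ L) {m n : ι → ℤ} (hmn : ∀ j, m j + 1 ≤ n j)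
    {k : ι} (hk : ∃ x ∈ L, x k = 1) {z : ℤ} (hz : m k ≤ z ∧ z ≤ n k) :
    ∃ x ∈ L, x k = z ∧ ∀ j, m j ≤ x j ∧ x j ≤ n j := by
  classical
  obtain ⟨x, hx, hxk⟩ := hk
  have key : ∀ j, ∃ v : ℤ, Even (v - z * x j) ∧ (j = k → v = z) ∧ m j ≤ v ∧ v ≤ n j := by
    intro j
    by_cases hj : j = k
    · subst hj
      exact ⟨z, by simp [hxk], fun _ => rfl, hz⟩
    · have hm := hmn j
      refine ⟨m j + (z * x j - m j) % 2, ?_, fun h => absurd h hj, by lia, by lia⟩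
      rw [Int.even_iff]
      generalize z * x j = t
      lia
  choose v hv hvk hvb using key
  refine ⟨v, ?_, hvk k rfl, hvb⟩
  have h := L.add_mem (hE (v - z • x) fun j => by simpa using hv j) (L.zsmul_mem hx z)
  simpa using h

/-- Span-vector formula: for a standard interleaved lattice `L` (a lattice with
`𝔼^p ⊆ L ⊆ ℤ^p` such that each coordinate value `1` is attained on `L`) and
scaling/translation vectors `b` (positive) and `c` with
`⌊(1−c_k)/b_k⌋ ≥ ⌈−c_k/b_k⌉ + 1` for every `k`, the number of distinct values
of the `k`-th coordinate of the design `D = ((b ⊗ L) ⊕ c) ∩ [0,1]^p` equals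
`⌊(1−c_k)/b_k⌋ − ⌈−c_k/b_k⌉ + 1`. -/
theorem stmt_13 (p : ℕ) (hp : 1 ≤ p) (L : AddSubgroup (Fin p → ℤ))
    (hE : ∀ x : Fin p → ℤ, (∀ k, Even (x k)) → x ∈ L)
    (hstd : ∀ k, ∃ x ∈ L, x k = 1)
    (b c : Fin p → ℝ) (hb : ∀ k, 0 < b k)
    (hbc : ∀ k, ⌈-c k / b k⌉ + 1 ≤ ⌊(1 - c k) / b k⌋)
    (D : Set (Fin p → ℝ))
    (hD : D = {y : Fin p → ℝ | (∃ x ∈ L, ∀ k, y k = b k * (x k : ℝ) + c k) ∧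
        ∀ k, 0 ≤ y k ∧ y k ≤ 1}) :
    ∀ k, (Set.ncard ((fun y : Fin p → ℝ => y k) '' D) : ℤ) =
      ⌊(1 - c k) / b k⌋ - ⌈-c k / b k⌉ + 1 := by
  intro k
  have himage : (fun y : Fin p → ℝ => y k) '' D =
      (fun z : ℤ => b k * (z : ℝ) + c k) ''
        (Finset.Icc ⌈-c k / b k⌉ ⌊(1 - c k) / b k⌋ : Set ℤ) := by
    subst hD
    ext t
    simp only [Set.mem_image, Set.mem_ofPred_eq, Finset.coe_Icc, Set.mem_Icc]
    constructor
    · rintro ⟨y, ⟨⟨x, -, hy⟩, hy01⟩, rfl⟩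
      refine ⟨x k, (affine_mem_unit_interval_iff (hb k) _).1 ?_, (hy k).symm⟩
      rw [← hy k]
      exact hy01 k
    · rintro ⟨z, hz, rfl⟩
      obtain ⟨x, hx, hxk, hxb⟩ := exists_mem_lattice_of_coord L hE hbc (hstd k) hz
      exact ⟨fun j => b j * (x j : ℝ) + c j, ⟨⟨x, hx, fun _ => rfl⟩,
        fun j => (affine_mem_unit_interval_iff (hb j) _).2 (hxb j)⟩, by simp [hxk]⟩
  have hinj : Function.Injective fun z : ℤ => b k * (z : ℝ) + c k := by
    intro z w h
    simpa [(hb k).ne'] using h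
  have hk := hbc k
  rw [himage, Set.ncard_image_of_injective _ hinj, Set.ncard_coe_finset, Int.card_Icc]
  lia
end

section
/- Let p ≥ 1 and let L be a lattice with 𝔼^p ⊆ L ⊆ ℤ^p. Then L is determined by L ∩ {e₁,…,e_p} and L₀: specifically, L equals the additive subgroup of ℤ^p generated by 𝔼^p ∪ L₀ ∪ {e_k : e_k ∈ L}. -/
/-- An integer vector lies in any subgroup containing the unit vectors of its support. -/
theorem AddSubgroup.mem_of_single_one_mem {ι : Type*} [Fintype ι] [DecidableEq ι]
    (M : AddSubgroup (ι → ℤ)) (z : ι → ℤ)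
    (h : ∀ k, z k ≠ 0 → Pi.single k (1 : ℤ) ∈ M) : z ∈ M := by
  rw [← Finset.univ_sum_single z]
  refine M.sum_mem fun k _ => ?_
  by_cases hk : z k = 0
  · simp [hk]
  · have hs : Pi.single k (z k) = z k • (Pi.single k (1 : ℤ) : ι → ℤ) := by
      rw [← Pi.single_smul]
      simp
    rw [hs]
    exact M.zsmul_mem (h k hk) _

/-- A lattice `L` with `𝔼^p ⊆ L ⊆ ℤ^p` is determined by `L ∩ {e₁,…,e_p}` and
`L₀`: `L` equals the additive subgroup of `ℤ^p` generated by
`𝔼^p ∪ L₀ ∪ {e_k : e_k ∈ L}`. -/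
theorem stmt_17 (p : ℕ) (hp : 1 ≤ p) (L : AddSubgroup (Fin p → ℤ))
    (hE : ∀ x : Fin p → ℤ, (∀ k, Even (x k)) → x ∈ L) :
    L = AddSubgroup.closure
      ({x : Fin p → ℤ | ∀ k, Even (x k)} ∪
        {x : Fin p → ℤ | x ∈ L ∧
          ∀ k, x k = 0 ∨ (x k = 1 ∧ Pi.single k (1 : ℤ) ∉ L)} ∪
        {x : Fin p → ℤ | ∃ k, Pi.single k (1 : ℤ) ∈ L ∧ x = Pi.single k (1 : ℤ)}) := by
  classical
  apply le_antisymm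
  · intro x hx
    let z : Fin p → ℤ := fun k => if Pi.single k (1 : ℤ) ∈ L then x k else 0
    let y : Fin p → ℤ := fun k => if Pi.single k (1 : ℤ) ∈ L then 0 else x k % 2
    let w : Fin p → ℤ := fun k => if Pi.single k (1 : ℤ) ∈ L then 0 else 2 * (x k / 2)
    have hxyz : x = w + y + z := by
      funext k
      by_cases hk : Pi.single k (1 : ℤ) ∈ L
      · simp [w, y, z, hk]
      · simp [w, y, z, hk, Int.mul_ediv_add_emod]
    have hw : ∀ k, Even (w k) := by
      intro k
      by_cases hk : Pi.single k (1 : ℤ) ∈ L <;> simp [w, hk]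
    have hz : ∀ k, z k ≠ 0 → Pi.single k (1 : ℤ) ∈ L := by
      intro k hk
      by_contra hkL
      exact hk (if_neg hkL)
    have hyL : y ∈ L := by
      have hy : y = x - w - z := by
        rw [hxyz]
        abel
      rw [hy]
      exact L.sub_mem (L.sub_mem hx (hE w hw)) (L.mem_of_single_one_mem z hz)
    have hy₀ : ∀ k, y k = 0 ∨ (y k = 1 ∧ Pi.single k (1 : ℤ) ∉ L) := by
      intro k
      by_cases hk : Pi.single k (1 : ℤ) ∈ L
      · exact Or.inl (if_pos hk)
      · have hyk : y k = x k % 2 := if_neg hk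
        rw [hyk]
        exact (Int.emod_two_eq_zero_or_one (x k)).imp_right fun h => ⟨h, hk⟩
    rw [hxyz]
    refine AddSubgroup.add_mem _ (AddSubgroup.add_mem _ ?_ ?_) ?_
    · exact AddSubgroup.subset_closure (Or.inl (Or.inl hw))
    · exact AddSubgroup.subset_closure (Or.inl (Or.inr ⟨hyL, hy₀⟩))
    · exact AddSubgroup.mem_of_single_one_mem _ z fun k hk =>
        AddSubgroup.subset_closure (Or.inr ⟨k, hz k hk, rfl⟩)
  · rw [AddSubgroup.closure_le]
    rintro x ((hx | hx) | ⟨k, hk, rfl⟩)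
    · exact hE x hx
    · exact hx.1
    · exact hk
end

section
/- Let p ≥ 1, let L be a lattice with 𝔼^p ⊆ L ⊆ ℤ^p, let w₁,…,w_p > 0, and let s, s′ ∈ ℕ^p with 2 ≤ s_k ≤ s′_k for every k. Then m(L,s) ≤ m(L,s′) and, provided |D(L,s)| ≥ 2, ρ(L,s′) ≤ ρ(L,s): enlarging the span vector does not decrease the design size and does not increase the separation distance. -/
lemma finite_lattice_inter_box {p : ℕ} (L : AddSubgroup (Fin p → ℤ)) (s : Fin p → ℕ) :
    {x : Fin p → ℤ | x ∈ L ∧ ∀ k, (0 : ℤ) ≤ x k ∧ x k < s k}.Finite :=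
  (Set.finite_Icc (0 : Fin p → ℤ) fun k => (s k : ℤ)).subset
    fun _ hx => ⟨fun k => (hx.2 k).1, fun k => (hx.2 k).2.le⟩

lemma weighted_length_scale_antitone {p : ℕ} {w : Fin p → ℝ} (hw : ∀ k, 0 < w k)
    {c c' : Fin p → ℝ} (hc : ∀ k, 0 < c k) (hcc' : ∀ k, c k ≤ c' k) (a b : Fin p → ℝ) :
    Real.sqrt (∑ k, (w k * |a k / c' k - b k / c' k|) ^ 2) ≤
      Real.sqrt (∑ k, (w k * |a k / c k - b k / c k|) ^ 2) := by
  refine Real.sqrt_le_sqrt (Finset.sum_le_sum fun k _ => ?_)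
  have hw := (hw k).le
  have hc := hc k
  have hc' := hc.trans_le (hcc' k)
  rw [← sub_div, ← sub_div, abs_div, abs_div, abs_of_pos hc, abs_of_pos hc']
  gcongr
  exact hcc' k

/-- Monotonicity in the span vector: for a lattice `L` with `𝔼^p ⊆ L ⊆ ℤ^p`
and span vectors `2 ≤ s_k ≤ s′_k`, the design size satisfies
`m(L,s) ≤ m(L,s′)`, and, provided `D(L,s)` has at least two points, the
separation distance satisfies `ρ(L,s′) ≤ ρ(L,s)`. -/
theorem stmt_18 (p : ℕ) (hp : 1 ≤ p) (L : AddSubgroup (Fin p → ℤ))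
    (hE : ∀ x : Fin p → ℤ, (∀ k, Even (x k)) → x ∈ L)
    (w : Fin p → ℝ) (hw : ∀ k, 0 < w k)
    (s s' : Fin p → ℕ) (hs : ∀ k, 2 ≤ s k) (hss' : ∀ k, s k ≤ s' k)
    (D D' : Set (Fin p → ℝ))
    (hD : D = {y : Fin p → ℝ | ∃ x ∈ L, (∀ k, (0 : ℤ) ≤ x k ∧ x k < s k) ∧
        ∀ k, y k = (x k : ℝ) / ((s k : ℝ) - 1)})
    (hD' : D' = {y : Fin p → ℝ | ∃ x ∈ L, (∀ k, (0 : ℤ) ≤ x k ∧ x k < s' k) ∧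
        ∀ k, y k = (x k : ℝ) / ((s' k : ℝ) - 1)})
    (hD2 : 2 ≤ D.ncard) :
    Set.ncard {x : Fin p → ℤ | x ∈ L ∧ ∀ k, (0 : ℤ) ≤ x k ∧ x k < s k} ≤
      Set.ncard {x : Fin p → ℤ | x ∈ L ∧ ∀ k, (0 : ℤ) ≤ x k ∧ x k < s' k} ∧
    sInf {r : ℝ | ∃ x ∈ D', ∃ y ∈ D', x ≠ y ∧
        r = Real.sqrt (∑ k, (w k * |x k - y k|) ^ 2)} ≤
      sInf {r : ℝ | ∃ x ∈ D, ∃ y ∈ D, x ≠ y ∧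
        r = Real.sqrt (∑ k, (w k * |x k - y k|) ^ 2)} := by
  refine ⟨Set.ncard_le_ncard (fun x hx => ⟨hx.1, fun k => ⟨(hx.2 k).1,
    (hx.2 k).2.trans_le (by exact_mod_cast hss' k)⟩⟩) (finite_lattice_inter_box L s'), ?_⟩
  have hc : ∀ k, (0 : ℝ) < (s k : ℝ) - 1 := fun k => by
    have : (2 : ℝ) ≤ s k := by exact_mod_cast hs k
    linarith
  have hcc' : ∀ k, (s k : ℝ) - 1 ≤ (s' k : ℝ) - 1 := fun k => by
    have : (s k : ℝ) ≤ s' k := by exact_mod_cast hss' k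
    linarith
  apply le_csInf
  · obtain ⟨x, y, hx, hy, hne⟩ :=
      (Set.one_lt_ncard_iff (Set.finite_of_ncard_pos (by omega))).1 (show 1 < D.ncard by omega)
    exact ⟨_, x, hx, y, hy, hne, rfl⟩
  rintro _ ⟨x, hx, y, hy, hne, rfl⟩
  rw [hD] at hx hy
  obtain ⟨a, ha, hab, hax⟩ := hx
  obtain ⟨b, hb, hbb, hby⟩ := hy
  have mem : ∀ z ∈ L, (∀ k, (0 : ℤ) ≤ z k ∧ z k < s k) →
      (fun k => (z k : ℝ) / ((s' k : ℝ) - 1)) ∈ D' := fun z hz hzb => by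
    rw [hD']
    exact ⟨z, hz, fun k => ⟨(hzb k).1, (hzb k).2.trans_le (by exact_mod_cast hss' k)⟩,
      fun _ => rfl⟩
  refine csInf_le_of_le ⟨0, ?_⟩ ⟨_, mem a ha hab, _, mem b hb hbb, ?_, rfl⟩ ?_
  · rintro _ ⟨_, _, _, _, _, rfl⟩
    exact Real.sqrt_nonneg _
  · refine fun h => hne (funext fun k => ?_)
    have hk := congrFun h k
    rw [hax, hby, (div_left_inj' ((hc k).trans_le (hcc' k)).ne').1 hk]
  · simp only [hax, hby]
    exact weighted_length_scale_antitone hw hc hcc' (fun k => a k) (fun k => b k)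
end
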